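/- Contracted direction in dimension 2. Let d = 2 and assume that the compact set K of Borel probability measures on SL(2,ℝ) satisfies the finite moment condition and the measures condition. Then for any fixed sequence (μᵢ)_{i∈ℕ} of measures from K, almost surely with respect to the infinite product measure there exists a unit vector v̄ ∈ ℝ² such that |Tₙ v̄| → 0 as n → ∞, and moreover lim_{n→∞} (1/n)(log|Tₙ v̄| + Lₙ) = 0. -/

import Mathlib

open MeasureTheory Matrix Filter
open scoped ENNReal

noncomputable section

/-- `SL(d, ℝ)`. -/
abbrev SL (d : ℕ) := Matrix.SpecialLinearGroup (Fin d) ℝ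

instance (d : ℕ) : TopologicalSpace (SL d) :=
  inferInstanceAs (TopologicalSpace { A : Matrix (Fin d) (Fin d) ℝ // A.det = 1 })

instance (d : ℕ) : MeasurableSpace (SL d) := borel _
instance (d : ℕ) : BorelSpace (SL d) := ⟨rfl⟩

/-- Operator norm of a real `d × d` matrix, acting on Euclidean space. -/
def opNorm {d : ℕ} (A : Matrix (Fin d) (Fin d) ℝ) : ℝ :=
  ‖Matrix.toEuclideanCLM (𝕜 := ℝ) A‖

/-- The norm `‖A‖` of `A ∈ SL(d, ℝ)`. -/
def slNorm {d : ℕ} (A : SL d) : ℝ := opNorm (A : Matrix (Fin d) (Fin d) ℝ)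

/-- `A` applied to a vector `v ∈ ℝ^d` (with the Euclidean norm). -/
def slVec {d : ℕ} (A : SL d) (v : EuclideanSpace ℝ (Fin d)) : EuclideanSpace ℝ (Fin d) :=
  Matrix.toEuclideanCLM (𝕜 := ℝ) (A : Matrix (Fin d) (Fin d) ℝ) v

/-- The random (reversed) product `Tₙ = Aₙ ⋯ A₂ A₁`, where `Aᵢ = ω (i-1)`. -/
def T {d : ℕ} (ω : ℕ → SL d) : ℕ → SL d
  | 0 => 1
  | n + 1 => ω n * T ω n

/-- The projective space `ℝP^{d-1}`. -/
abbrev Proj (d : ℕ) := Projectivization ℝ (Fin d → ℝ)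

instance (d : ℕ) : TopologicalSpace (Proj d) :=
  inferInstanceAs (TopologicalSpace (Quotient (projectivizationSetoid ℝ (Fin d → ℝ))))

instance (d : ℕ) : MeasurableSpace (Proj d) := borel _
instance (d : ℕ) : BorelSpace (Proj d) := ⟨rfl⟩

/-- The linear map induced by `A ∈ SL(d, ℝ)` is injective. -/
theorem toLin'_injective {d : ℕ} (A : SL d) :
    Function.Injective (Matrix.toLin' (A : Matrix (Fin d) (Fin d) ℝ)) := by
  apply Function.LeftInverse.injective
    (g := Matrix.toLin' ((A⁻¹ : SL d) : Matrix (Fin d) (Fin d) ℝ))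
  intro x
  rw [← Matrix.toLin'_mul_apply, ← Matrix.SpecialLinearGroup.coe_mul, inv_mul_cancel,
    Matrix.SpecialLinearGroup.coe_one, Matrix.toLin'_one, LinearMap.id_apply]

/-- The projective map `f_A : ℝP^{d-1} → ℝP^{d-1}` induced by `A ∈ SL(d, ℝ)`. -/
def projMap {d : ℕ} (A : SL d) : Proj d → Proj d :=
  Projectivization.map (Matrix.toLin' (A : Matrix (Fin d) (Fin d) ℝ)) (toLin'_injective A)

/-- The subset `[L] ⊆ ℝP^{d-1}` corresponding to a linear subspace `L ≤ ℝ^d`. -/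
def projSet {d : ℕ} (L : Submodule ℝ (Fin d → ℝ)) : Set (Proj d) :=
  {x : Proj d | x.submodule ≤ L}

/-- Finite moment condition for a single measure, with exponent `γ` and bound `C`. -/
def FiniteMomentCondition {d : ℕ} (γ C : ℝ) (μ : ProbabilityMeasure (SL d)) : Prop :=
  ∫⁻ A, ENNReal.ofReal (slNorm A ^ γ) ∂(μ : Measure (SL d)) < ENNReal.ofReal C

/-- Log-moment condition: `∫ log ‖A‖ dμ(A) < ∞`. -/
def LogMomentCondition {d : ℕ} (μ : ProbabilityMeasure (SL d)) : Prop :=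
  ∫⁻ A, ENNReal.ofReal (Real.log (slNorm A)) ∂(μ : Measure (SL d)) < ⊤

/-- Measures condition: there are no Borel probability measures `ν₁`, `ν₂` on `ℝP^{d-1}`
with `(f_A)_* ν₁ = ν₂` for `μ`-a.e. `A`. -/
def MeasuresCondition {d : ℕ} (μ : ProbabilityMeasure (SL d)) : Prop :=
  ¬ ∃ (ν₁ ν₂ : ProbabilityMeasure (Proj d)),
      ∀ᵐ A ∂(μ : Measure (SL d)),
        (ν₁ : Measure (Proj d)).map (projMap A) = (ν₂ : Measure (Proj d))

/-- `U ⊆ ℝ^d` is a (nonempty) finite union of proper nonzero linear subspaces. -/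
def IsFiniteUnionOfProperSubspaces {d : ℕ} (U : Set (Fin d → ℝ)) : Prop :=
  ∃ S : Set (Submodule ℝ (Fin d → ℝ)), S.Finite ∧ S.Nonempty ∧
    (∀ W ∈ S, W ≠ ⊥ ∧ W ≠ ⊤) ∧ U = ⋃ W ∈ S, (W : Set (Fin d → ℝ))

/-- `U ⊆ ℝ^d` is a (nonempty) finite union of `j`-dimensional linear subspaces. -/
def IsFiniteUnionOfDimSubspaces {d : ℕ} (j : ℕ) (U : Set (Fin d → ℝ)) : Prop :=
  ∃ S : Set (Submodule ℝ (Fin d → ℝ)), S.Finite ∧ S.Nonempty ∧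
    (∀ W ∈ S, Module.finrank ℝ W = j) ∧ U = ⋃ W ∈ S, (W : Set (Fin d → ℝ))

/-- Spaces condition: there are no two finite unions `U`, `U'` of proper nonzero subspaces
of `ℝ^d` such that `A(U) = U'` for `μ`-a.e. `A`. -/
def SpacesCondition {d : ℕ} (μ : ProbabilityMeasure (SL d)) : Prop :=
  ¬ ∃ U U' : Set (Fin d → ℝ), IsFiniteUnionOfProperSubspaces U ∧
      IsFiniteUnionOfProperSubspaces U' ∧
      ∀ᵐ (A : SL d) ∂(μ : Measure (SL d)),
        (fun v => Matrix.toLin' (A : Matrix (Fin d) (Fin d) ℝ) v) '' U = U'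

/-- `ℙ` is the product measure `μ₁ × μ₂ × ⋯` on sequences, characterized by its
finite-dimensional marginals. -/
def IsProductMeasure {d : ℕ} (μ : ℕ → ProbabilityMeasure (SL d))
    (ℙ : Measure (ℕ → SL d)) : Prop :=
  IsProbabilityMeasure ℙ ∧
    ∀ n : ℕ, ℙ.map (fun ω (i : Fin n) => ω i) =
      Measure.pi (fun i : Fin n => ((μ i : Measure (SL d))))

/-- `Lₙ = E log ‖Tₙ‖`. -/
def L {d : ℕ} (ℙ : Measure (ℕ → SL d)) (n : ℕ) : ℝ :=
  ∫ ω, Real.log (slNorm (T ω n)) ∂ℙ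

/-- `L_{[n,m]} = E log ‖A_m ⋯ A_{n+1}‖`. -/
def Lseg {d : ℕ} (ℙ : Measure (ℕ → SL d)) (n m : ℕ) : ℝ :=
  ∫ ω, Real.log (slNorm (T ω m * (T ω n)⁻¹)) ∂ℙ

instance (d : ℕ) : IsTopologicalGroup (SL d) where
  continuous_mul := (Matrix.SpecialLinearGroup.topologicalGroup (n := Fin d) (R := ℝ)).continuous_mul
  continuous_inv := (Matrix.SpecialLinearGroup.topologicalGroup (n := Fin d) (R := ℝ)).continuous_inv

instance (d : ℕ) : SecondCountableTopology (SL d) :=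
  haveI : SecondCountableTopology (Matrix (Fin d) (Fin d) ℝ) :=
    inferInstanceAs (SecondCountableTopology (Fin d → Fin d → ℝ))
  TopologicalSpace.Subtype.secondCountableTopology
    {A : Matrix (Fin d) (Fin d) ℝ | A.det = 1}

instance (d : ℕ) : T2Space (SL d) :=
  inferInstanceAs (T2Space { A : Matrix (Fin d) (Fin d) ℝ // A.det = 1 })

theorem continuous_coe_SL {d : ℕ} :
    Continuous (fun A : SL d => (A : Matrix (Fin d) (Fin d) ℝ)) :=
  continuous_subtype_val

theorem slVec_mul {d : ℕ} (A B : SL d) (v : EuclideanSpace ℝ (Fin d)) :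
    slVec (A * B) v = slVec A (slVec B v) := by
  simp [slVec]

theorem slVec_one {d : ℕ} (v : EuclideanSpace ℝ (Fin d)) : slVec 1 v = v := by
  simp [slVec]

theorem slVec_smul {d : ℕ} (A : SL d) (c : ℝ) (v : EuclideanSpace ℝ (Fin d)) :
    slVec A (c • v) = c • slVec A v := by
  simp [slVec]

theorem slVec_sub {d : ℕ} (A : SL d) (v w : EuclideanSpace ℝ (Fin d)) :
    slVec A (v - w) = slVec A v - slVec A w := by
  simp [slVec]

theorem slVec_inv_slVec {d : ℕ} (A : SL d) (v : EuclideanSpace ℝ (Fin d)) :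
    slVec A⁻¹ (slVec A v) = v := by
  rw [← slVec_mul, inv_mul_cancel, slVec_one]

theorem slVec_slVec_inv {d : ℕ} (A : SL d) (v : EuclideanSpace ℝ (Fin d)) :
    slVec A (slVec A⁻¹ v) = v := by
  rw [← slVec_mul, mul_inv_cancel, slVec_one]

theorem norm_slVec_le {d : ℕ} (A : SL d) (v : EuclideanSpace ℝ (Fin d)) :
    ‖slVec A v‖ ≤ slNorm A * ‖v‖ :=
  ContinuousLinearMap.le_opNorm _ _

theorem slNorm_nonneg {d : ℕ} (A : SL d) : 0 ≤ slNorm A := norm_nonneg _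

theorem slNorm_mul_le {d : ℕ} (A B : SL d) : slNorm (A * B) ≤ slNorm A * slNorm B := by
  simp only [slNorm, opNorm, Matrix.SpecialLinearGroup.coe_mul, map_mul]
  exact norm_mul_le _ _

theorem slVec_apply_two (A : SL 2) (v : EuclideanSpace ℝ (Fin 2)) (i : Fin 2) :
    slVec A v i = A.1 i 0 * v 0 + A.1 i 1 * v 1 := by
  simp [slVec, Matrix.ofLp_toEuclideanCLM, Matrix.mulVec, dotProduct, Fin.sum_univ_two]

/-- The signed area spanned by two plane vectors. -/
def wedge (v w : EuclideanSpace ℝ (Fin 2)) : ℝ := v 0 * w 1 - v 1 * w 0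

theorem wedge_slVec (A : SL 2) (v w : EuclideanSpace ℝ (Fin 2)) :
    wedge (slVec A v) (slVec A w) = wedge v w := by
  have h := A.2
  rw [Matrix.det_fin_two] at h
  simp only [wedge, slVec_apply_two]
  linear_combination (v 0 * w 1 - v 1 * w 0) * h

theorem norm_sq_two (v : EuclideanSpace ℝ (Fin 2)) : ‖v‖ ^ 2 = v 0 ^ 2 + v 1 ^ 2 := by
  simp [EuclideanSpace.norm_sq_eq, Fin.sum_univ_two]

theorem abs_wedge_le (v w : EuclideanSpace ℝ (Fin 2)) : |wedge v w| ≤ ‖v‖ * ‖w‖ := by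
  apply abs_le_of_sq_le_sq _ (by positivity)
  rw [mul_pow, norm_sq_two, norm_sq_two, wedge]
  nlinarith [sq_nonneg (v 0 * w 0 + v 1 * w 1)]

theorem norm_le_slNorm_mul (A : SL 2) (v : EuclideanSpace ℝ (Fin 2)) :
    ‖v‖ ≤ slNorm A * ‖slVec A v‖ := by
  set w : EuclideanSpace ℝ (Fin 2) := !₂[-v 1, v 0] with hw
  have h1 : wedge v w = ‖v‖ ^ 2 := by
    rw [norm_sq_two, wedge, hw]; simp; ring
  have h2 : ‖w‖ = ‖v‖ := by
    have : ‖w‖ ^ 2 = ‖v‖ ^ 2 := by rw [norm_sq_two, norm_sq_two, hw]; simp; ring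
    exact (sq_eq_sq₀ (norm_nonneg _) (norm_nonneg _)).1 this
  have h3 := abs_wedge_le (slVec A v) (slVec A w)
  rw [wedge_slVec, h1, abs_of_nonneg (sq_nonneg _)] at h3
  have h4 := norm_slVec_le A w
  rw [h2] at h4
  rcases (norm_nonneg v).eq_or_lt with h0 | h0
  · rw [← h0]; exact mul_nonneg (slNorm_nonneg A) (norm_nonneg _)
  · have : ‖v‖ * ‖v‖ ≤ ‖v‖ * (slNorm A * ‖slVec A v‖) := by
      nlinarith [norm_nonneg (slVec A v)]
    exact le_of_mul_le_mul_left this h0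

theorem one_le_slNorm (A : SL 2) : 1 ≤ slNorm A := by
  set v : EuclideanSpace ℝ (Fin 2) := EuclideanSpace.single 0 1
  have hv : ‖v‖ = 1 := by simp [v]
  have h1 := norm_le_slNorm_mul A v
  have h2 := norm_slVec_le A v
  rw [hv] at h1 h2
  have := slNorm_nonneg A
  by_contra! h
  nlinarith [norm_nonneg (slVec A v)]

theorem slNorm_pos (A : SL 2) : 0 < slNorm A := zero_lt_one.trans_le (one_le_slNorm A)

theorem norm_slVec_inv_le (A : SL 2) (v : EuclideanSpace ℝ (Fin 2)) :
    ‖slVec A⁻¹ v‖ ≤ slNorm A * ‖v‖ := by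
  simpa [slVec_slVec_inv] using norm_le_slNorm_mul A (slVec A⁻¹ v)

theorem slVec_ne_zero (A : SL 2) {v : EuclideanSpace ℝ (Fin 2)} (hv : v ≠ 0) :
    slVec A v ≠ 0 := by
  intro h
  apply hv
  rw [← slVec_inv_slVec A v, h]; simp [slVec]

/-- A matrix stretches every vector at least in proportion to its component along some
fixed unit vector. -/
theorem exists_unit_expanding (A : SL 2) :
    ∃ z : EuclideanSpace ℝ (Fin 2), ‖z‖ = 1 ∧
      ∀ u, slNorm A / 2 * |inner ℝ z u| ≤ ‖slVec A u‖ := by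
  set F := Matrix.toEuclideanCLM (𝕜 := ℝ) (A : Matrix (Fin 2) (Fin 2) ℝ) with hF
  have hn : ‖ContinuousLinearMap.adjoint F‖ = slNorm A := by
    rw [LinearIsometryEquiv.norm_map]; rfl
  have hpos := slNorm_pos A
  obtain ⟨y, hy1, hy2⟩ := ContinuousLinearMap.exists_lt_apply_of_lt_opNorm
    (ContinuousLinearMap.adjoint F) (r := slNorm A / 2) (by rw [hn]; linarith)
  set w := ContinuousLinearMap.adjoint F y with hw
  have hw0 : 0 < ‖w‖ := by linarith
  refine ⟨‖w‖⁻¹ • w, ?_, fun u => ?_⟩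
  · rw [norm_smul, norm_inv, norm_norm, inv_mul_cancel₀ hw0.ne']
  · have h1 : inner ℝ w u = inner ℝ y (slVec A u) := by
      rw [hw, ContinuousLinearMap.adjoint_inner_left]; rfl
    have h2 : |inner ℝ y (slVec A u)| ≤ ‖slVec A u‖ :=
      (abs_real_inner_le_norm _ _).trans
        (mul_le_of_le_one_left (norm_nonneg _) hy1.le)
    rw [real_inner_smul_left, abs_mul, abs_inv, abs_norm, h1]
    calc slNorm A / 2 * (‖w‖⁻¹ * |inner ℝ y (slVec A u)|)
        = (slNorm A / 2 / ‖w‖) * |inner ℝ y (slVec A u)| := by ring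
      _ ≤ 1 * |inner ℝ y (slVec A u)| := by
          gcongr
          rw [div_le_one hw0]; exact hy2.le
      _ ≤ _ := by rw [one_mul]; exact h2

theorem continuous_toEuclideanCLM_SL :
    Continuous (fun A : SL 2 =>
      Matrix.toEuclideanCLM (𝕜 := ℝ) (A : Matrix (Fin 2) (Fin 2) ℝ)) := by
  let F : Matrix (Fin 2) (Fin 2) ℝ →ₗ[ℝ] _ :=
    (Matrix.toEuclideanCLM (𝕜 := ℝ) (n := Fin 2)).toAlgEquiv.toLinearMap
  have h : Continuous F := LinearMap.continuous_of_finiteDimensional _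
  exact h.comp continuous_coe_SL

theorem continuous_slNorm : Continuous (slNorm : SL 2 → ℝ) :=
  continuous_toEuclideanCLM_SL.norm

theorem continuous_slVec :
    Continuous (fun p : SL 2 × EuclideanSpace ℝ (Fin 2) => slVec p.1 p.2) :=
  (continuous_toEuclideanCLM_SL.comp continuous_fst).clm_apply continuous_snd

theorem abs_coe_le_slNorm (A : SL 2) (i j : Fin 2) : |A.1 i j| ≤ slNorm A := by
  have h := norm_slVec_le A (EuclideanSpace.single j 1)
  have h2 := PiLp.norm_apply_le (slVec A (EuclideanSpace.single j 1)) i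
  rw [slVec_apply_two] at h2
  fin_cases j <;> simp at h h2 ⊢ <;> linarith

theorem isCompact_slNorm_le (R : ℝ) : IsCompact {A : SL 2 | slNorm A ≤ R} := by
  have hcl : Topology.IsClosedEmbedding
      (fun A : SL 2 => (A : Matrix (Fin 2) (Fin 2) ℝ)) :=
    (isClosed_singleton.preimage continuous_id.matrix_det).isClosedEmbedding_subtypeVal
  have hK : IsCompact (Set.pi Set.univ fun _ : Fin 2 => Set.pi Set.univ fun _ : Fin 2 =>
      Set.Icc (-R) R) :=
    isCompact_univ_pi fun _ => isCompact_univ_pi fun _ => isCompact_Icc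
  refine (hcl.isCompact_preimage hK).of_isClosed_subset
    (isClosed_le continuous_slNorm continuous_const) fun A hA => ?_
  exact fun i _ j _ => abs_le.1 ((abs_coe_le_slNorm A i j).trans hA)

/-- The unit circle. -/
abbrev Circ : Type := Metric.sphere (0 : EuclideanSpace ℝ (Fin 2)) 1

/-- The direction of a vector (with a junk value at `0`). -/
def dir (v : EuclideanSpace ℝ (Fin 2)) : Circ :=
  if h : v = 0 then ⟨EuclideanSpace.single 0 1, by simp⟩
  else ⟨‖v‖⁻¹ • v, by simp [norm_smul, h]⟩

theorem coe_dir {v : EuclideanSpace ℝ (Fin 2)} (h : v ≠ 0) :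
    (dir v : EuclideanSpace ℝ (Fin 2)) = ‖v‖⁻¹ • v := by
  simp [dir, h]

theorem Circ.ne_zero (x : Circ) : (x : EuclideanSpace ℝ (Fin 2)) ≠ 0 := by
  have := norm_eq_of_mem_sphere x
  intro h; rw [h] at this; simp at this

theorem dir_coe (x : Circ) : dir x = x := by
  ext1; rw [coe_dir x.ne_zero]; simp

theorem dir_smul {c : ℝ} (hc : 0 < c) (v : EuclideanSpace ℝ (Fin 2)) : dir (c • v) = dir v := by
  by_cases h : v = 0
  · simp [h]
  · have h' : c • v ≠ 0 := smul_ne_zero hc.ne' h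
    ext1
    rw [coe_dir h, coe_dir h', smul_smul, norm_smul, Real.norm_of_nonneg hc.le]
    congr 1
    have : ‖v‖ ≠ 0 := norm_ne_zero_iff.2 h
    field_simp

/-- The action of `SL(2, ℝ)` on the circle of directions. -/
def circAct (A : SL 2) (x : Circ) : Circ := dir (slVec A x)

theorem dir_slVec (A : SL 2) {v : EuclideanSpace ℝ (Fin 2)} (hv : v ≠ 0) :
    dir (slVec A v) = circAct A (dir v) := by
  rw [circAct, coe_dir hv, slVec_smul, dir_smul (inv_pos.2 (norm_pos_iff.2 hv))]

theorem circAct_mul (A B : SL 2) (x : Circ) :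
    circAct (A * B) x = circAct A (circAct B x) := by
  rw [circAct, slVec_mul, dir_slVec _ (slVec_ne_zero _ x.ne_zero)]; rfl

theorem circAct_one (x : Circ) : circAct 1 x = x := by
  rw [circAct, slVec_one, dir_coe]

theorem continuousOn_dir : ContinuousOn dir {0}ᶜ := by
  rw [Topology.IsInducing.subtypeVal.continuousOn_iff]
  have h : ContinuousOn (fun v : EuclideanSpace ℝ (Fin 2) => ‖v‖⁻¹ • v) {0}ᶜ := by
    refine ContinuousOn.fun_smul ?_ continuousOn_id
    exact continuous_norm.continuousOn.inv₀ fun v hv => norm_ne_zero_iff.2 hv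
  exact h.congr fun v hv => coe_dir hv

theorem measurable_dir : Measurable dir := by
  have h1 : Measurable (fun v : EuclideanSpace ℝ (Fin 2) => (dir v : EuclideanSpace ℝ (Fin 2))) := by
    have : (fun v : EuclideanSpace ℝ (Fin 2) => (dir v : EuclideanSpace ℝ (Fin 2))) =
        fun v => if v = 0 then EuclideanSpace.single 0 1 else ‖v‖⁻¹ • v := by
      ext1 v
      by_cases h : v = 0
      · simp [dir, h]
      · simp [coe_dir h, h]
    rw [this]
    exact Measurable.ite (measurableSet_singleton 0) measurable_const
      (measurable_norm.inv.smul measurable_id)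
  exact h1.subtype_mk

theorem continuous_circAct : Continuous (fun p : SL 2 × Circ => circAct p.1 p.2) := by
  have h : Continuous (fun p : SL 2 × Circ => slVec p.1 (p.2 : EuclideanSpace ℝ (Fin 2))) :=
    continuous_slVec.comp
      (f := fun p : SL 2 × Circ => (p.1, (p.2 : EuclideanSpace ℝ (Fin 2))))
      (continuous_fst.prodMk (continuous_subtype_val.comp continuous_snd))
  exact continuousOn_dir.comp_continuous h fun p => slVec_ne_zero p.1 p.2.ne_zero

/-- Integrating a bounded continuous function of a parameter and a point against a tight,
weakly continuous family of probability measures is jointly continuous. -/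
theorem continuous_integral_of_tight {Θ G κ : Type*} [TopologicalSpace Θ] [TopologicalSpace G]
    [T2Space G] [MeasurableSpace G] [BorelSpace G] [TopologicalSpace κ]
    {P : κ → ProbabilityMeasure G} (hP : Continuous P)
    (htight : ∀ ε > 0, ∃ C : Set G, IsCompact C ∧ ∀ k, (P k : Measure G).real Cᶜ ≤ ε)
    {h : Θ × G → ℝ} (hc : Continuous h) {M : ℝ} (hM : ∀ p, |h p| ≤ M) :
    Continuous (fun p : Θ × κ => ∫ a, h (p.1, a) ∂(P p.2 : Measure G)) := by
  have hint : ∀ θ k, Integrable (fun a => h (θ, a)) (P k : Measure G) := fun θ k =>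
    Integrable.of_bound (hc.comp (Continuous.prodMk_right θ)).measurable.aestronglyMeasurable M
      (Eventually.of_forall fun a => hM _)
  rw [continuous_iff_continuousAt]
  rintro ⟨θ₀, k₀⟩
  obtain ⟨a₀⟩ : Nonempty G := (P k₀).nonempty
  have hM0 : 0 ≤ M := (abs_nonneg _).trans (hM (θ₀, a₀))
  rw [ContinuousAt, Metric.tendsto_nhds]
  intro ε hε
  set ε' := ε / (4 * (1 + M)) with hε'
  have hε'0 : 0 < ε' := by positivity
  obtain ⟨C, hC, hCP⟩ := htight ε' hε'0
  have h1 : ∀ᶠ θ in nhds θ₀, ∀ a ∈ C, |h (θ, a) - h (θ₀, a)| < ε' := by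
    apply hC.eventually_forall_of_forall_eventually
    intro a _
    have : Continuous (fun z : Θ × G => |h (z.1, z.2) - h (θ₀, z.2)|) := by fun_prop
    have h2 := this.tendsto (θ₀, a)
    simp only [sub_self, abs_zero] at h2
    exact h2.eventually_lt_const hε'0
  have h2 : ∀ᶠ k in nhds k₀, |∫ a, h (θ₀, a) ∂(P k : Measure G) -
      ∫ a, h (θ₀, a) ∂(P k₀ : Measure G)| < ε / 2 := by
    let F : BoundedContinuousFunction G ℝ := BoundedContinuousFunction.ofNormedAddCommGroup
      (fun a => h (θ₀, a)) (hc.comp (Continuous.prodMk_right θ₀)) M (fun a => hM _)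
    have h3 := (ProbabilityMeasure.tendsto_iff_forall_integral_tendsto.1 (hP.tendsto k₀)) F
    have h4 := (Metric.tendsto_nhds.1 h3) (ε / 2) (by positivity)
    exact h4
  rw [nhds_prod_eq]
  filter_upwards [h1.prod_inl _, h2.prod_inr _] with ⟨θ, k⟩ ha hb
  simp only at ha hb
  rw [Real.dist_eq]
  have h5 : |∫ a, h (θ, a) ∂(P k : Measure G) - ∫ a, h (θ₀, a) ∂(P k : Measure G)| ≤
      ε' + 2 * M * ε' := by
    rw [← integral_sub (hint _ _) (hint _ _)]
    have hCm : MeasurableSet Cᶜ := hC.measurableSet.compl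
    calc |∫ a, (h (θ, a) - h (θ₀, a)) ∂(P k : Measure G)|
        ≤ ∫ a, |h (θ, a) - h (θ₀, a)| ∂(P k : Measure G) := abs_integral_le_integral_abs
      _ ≤ ∫ a, (ε' + Cᶜ.indicator (fun _ => 2 * M) a) ∂(P k : Measure G) := by
          apply integral_mono ((hint _ _).sub (hint _ _)).abs
          · exact (integrable_const _).add ((integrable_const _).indicator hCm)
          · intro a
            by_cases hac : a ∈ C
            · simpa [hac] using (ha a hac).le
            · have := abs_sub (h (θ, a)) (h (θ₀, a))
              have e1 := hM (θ, a)
              have e2 := hM (θ₀, a)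
              simp only [Set.mem_compl_iff, hac, not_false_eq_true, Set.indicator_of_mem]
              change |h (θ, a) - h (θ₀, a)| ≤ _
              linarith
      _ = ε' + 2 * M * (P k : Measure G).real Cᶜ := by
          rw [integral_add (integrable_const _) ((integrable_const _).indicator hCm),
            integral_indicator_const _ hCm]
          simp [mul_comm]
      _ ≤ _ := by gcongr; exact hCP k
  have h6 : ε' + 2 * M * ε' < ε / 2 := by
    have : ε' * (4 * (1 + M)) = ε := by rw [hε']; field_simp
    nlinarith
  calc |∫ a, h (θ, a) ∂(P k : Measure G) - ∫ a, h (θ₀, a) ∂(P k₀ : Measure G)|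
      ≤ _ := abs_sub_le _ (∫ a, h (θ₀, a) ∂(P k : Measure G)) _
    _ < ε := by linarith

/-- The special case of a compact sample space, where all families are tight. -/
theorem continuous_integral_of_compactSpace {Θ G : Type*} [TopologicalSpace Θ]
    [TopologicalSpace G] [T2Space G] [CompactSpace G] [MeasurableSpace G] [BorelSpace G]
    {h : Θ × G → ℝ} (hc : Continuous h) {M : ℝ} (hM : ∀ p, |h p| ≤ M) :
    Continuous (fun p : Θ × ProbabilityMeasure G => ∫ a, h (p.1, a) ∂(p.2 : Measure G)) :=
  continuous_integral_of_tight continuous_id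
    (fun ε hε => ⟨Set.univ, isCompact_univ, fun k => by simpa using hε.le⟩) hc hM

theorem measurable_slNorm : Measurable (slNorm : SL 2 → ℝ) := continuous_slNorm.measurable

theorem FiniteMomentCondition.one_lt {γ C : ℝ} (hγ : 0 < γ) {μ : ProbabilityMeasure (SL 2)}
    (h : FiniteMomentCondition γ C μ) : 1 < C := by
  have h1 : (1 : ℝ≥0∞) ≤ ∫⁻ A, ENNReal.ofReal (slNorm A ^ γ) ∂(μ : Measure (SL 2)) := by
    calc (1 : ℝ≥0∞) = ∫⁻ _, 1 ∂(μ : Measure (SL 2)) := by simp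
      _ ≤ _ := lintegral_mono fun A => by
          rw [← ENNReal.ofReal_one]
          exact ENNReal.ofReal_le_ofReal (Real.one_le_rpow (one_le_slNorm A) hγ.le)
  have h2 := h1.trans_lt h
  rwa [← ENNReal.ofReal_one, ENNReal.ofReal_lt_ofReal_iff_of_nonneg zero_le_one] at h2

theorem tight_of_finiteMoment {K : Set (ProbabilityMeasure (SL 2))} {γ C : ℝ} (hγ : 0 < γ)
    (hmom : ∀ μ ∈ K, FiniteMomentCondition γ C μ) :
    ∀ ε > 0, ∃ D : Set (SL 2), IsCompact D ∧
      ∀ k : K, ((k : ProbabilityMeasure (SL 2)) : Measure (SL 2)).real Dᶜ ≤ ε := by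
  intro ε hε
  rcases K.eq_empty_or_nonempty with rfl | ⟨μ₀, hμ₀⟩
  · exact ⟨∅, isCompact_empty, fun k => k.2.elim⟩
  have hC : 1 < C := (hmom μ₀ hμ₀).one_lt hγ
  set R := (C / ε) ^ γ⁻¹ with hR
  have hCε : 0 < C / ε := by positivity
  have hR0 : 0 < R := Real.rpow_pos_of_pos hCε _
  have hRγ : R ^ γ = C / ε := by rw [hR, ← Real.rpow_mul hCε.le, inv_mul_cancel₀ hγ.ne',
    Real.rpow_one]
  refine ⟨_, isCompact_slNorm_le R, fun k => ?_⟩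
  have h1 := mul_meas_ge_le_lintegral₀ (μ := ((k : ProbabilityMeasure (SL 2)) : Measure (SL 2)))
    (f := fun A => ENNReal.ofReal (slNorm A ^ γ))
    (measurable_slNorm.pow_const γ).ennreal_ofReal.aemeasurable (ENNReal.ofReal (C / ε))
  have h2 := h1.trans (hmom k k.2).le
  have h3 : {A : SL 2 | slNorm A ≤ R}ᶜ ⊆
      {A | ENNReal.ofReal (C / ε) ≤ ENNReal.ofReal (slNorm A ^ γ)} := by
    intro A hA
    simp only [Set.mem_compl_iff, Set.mem_ofPred_eq, not_le] at hA
    apply ENNReal.ofReal_le_ofReal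
    rw [← hRγ]
    exact Real.rpow_le_rpow hR0.le hA.le hγ.le
  have h4 := (mul_le_mul_right (measure_mono h3) (ENNReal.ofReal (C / ε))).trans h2
  have h5 := ENNReal.toReal_mono ENNReal.ofReal_ne_top h4
  rw [ENNReal.toReal_mul, ENNReal.toReal_ofReal hCε.le, ENNReal.toReal_ofReal (by linarith)] at h5
  rw [Measure.real]
  rw [div_mul_eq_mul_div, div_le_iff₀ hε] at h5
  exact le_of_mul_le_mul_left h5 (by linarith)

/-- The projection from the circle of directions to the projective line. -/
def circProj (x : Circ) : Proj 2 :=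
  Projectivization.mk ℝ (WithLp.ofLp (x : EuclideanSpace ℝ (Fin 2))) (by
    simpa using x.ne_zero)

theorem continuous_circProj : Continuous circProj := by
  have h : Continuous (fun x : Circ => (⟨WithLp.ofLp (x : EuclideanSpace ℝ (Fin 2)), by
    simpa using x.ne_zero⟩ : { v : Fin 2 → ℝ // v ≠ 0 })) :=
    Continuous.subtype_mk
      ((PiLp.continuous_ofLp 2 (fun _ : Fin 2 => ℝ)).comp continuous_subtype_val) _
  exact (continuous_quotient_mk' (s := projectivizationSetoid ℝ (Fin 2 → ℝ))).comp h

theorem continuous_projMap (A : SL 2) : Continuous (projMap A) := by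
  have h : Continuous (fun v : { v : Fin 2 → ℝ // v ≠ 0 } =>
      (⟨Matrix.toLin' (A : Matrix (Fin 2) (Fin 2) ℝ) v, by
        rw [Ne, map_eq_zero_iff _ (toLin'_injective A)]; exact v.2⟩ :
          { v : Fin 2 → ℝ // v ≠ 0 })) :=
    Continuous.subtype_mk
      ((LinearMap.continuous_of_finiteDimensional _).comp continuous_subtype_val) _
  exact (isQuotientMap_quotient_mk' (s := projectivizationSetoid ℝ (Fin 2 → ℝ))).continuous_iff.2
    ((continuous_quotient_mk' (s := projectivizationSetoid ℝ (Fin 2 → ℝ))).comp h)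

theorem measurable_circAct (A : SL 2) : Measurable (circAct A) :=
  (continuous_circAct.comp (Continuous.prodMk_right A)).measurable

theorem projMap_circProj (A : SL 2) (x : Circ) :
    projMap A (circProj x) = circProj (circAct A x) := by
  rw [projMap, circProj, Projectivization.map_mk, circProj, Projectivization.mk_eq_mk_iff']
  refine ⟨‖slVec A x‖, ?_⟩
  have h : slVec A (x : EuclideanSpace ℝ (Fin 2)) ≠ 0 := slVec_ne_zero A x.ne_zero
  rw [circAct, coe_dir h, WithLp.ofLp_smul, smul_smul, mul_inv_cancel₀ (norm_ne_zero_iff.2 h),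
    one_smul]
  simp [slVec, Matrix.ofLp_toEuclideanCLM]

/-- The measures condition, stated on the circle of directions. -/
theorem MeasuresCondition.not_ae_map_circAct {μ : ProbabilityMeasure (SL 2)}
    (h : MeasuresCondition μ) (ν₁ ν₂ : ProbabilityMeasure Circ) :
    ¬ ∀ᵐ A ∂(μ : Measure (SL 2)),
      (ν₁ : Measure Circ).map (circAct A) = (ν₂ : Measure Circ) := by
  intro hA
  apply h
  have hm := continuous_circProj.measurable
  refine ⟨ν₁.map hm.aemeasurable, ν₂.map hm.aemeasurable, ?_⟩
  filter_upwards [hA] with A hA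
  simp only [ProbabilityMeasure.toMeasure_map]
  rw [Measure.map_map (continuous_projMap A).measurable hm, ← hA, Measure.map_map hm
    (measurable_circAct A)]
  congr 1
  ext1 x
  exact projMap_circProj A x

theorem abs_integral_continuousMap_le {X : Type*} [TopologicalSpace X] [CompactSpace X]
    [MeasurableSpace X] (ν : ProbabilityMeasure X) (f : X → X) (φ : C(X, ℝ)) :
    |∫ s, φ (f s) ∂(ν : Measure X)| ≤ ‖φ‖ := by
  have h := norm_integral_le_of_norm_le_const (μ := (ν : Measure X)) (f := fun s => φ (f s))
    (C := ‖φ‖) (Eventually.of_forall fun s => φ.norm_coe_le_norm _)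
  simpa using h

theorem continuous_integral_circAct (φ : C(Circ, ℝ)) :
    Continuous (fun p : SL 2 × ProbabilityMeasure Circ =>
      ∫ s, φ (circAct p.1 s) ∂(p.2 : Measure Circ)) :=
  continuous_integral_of_compactSpace (h := fun q : SL 2 × Circ => φ (circAct q.1 q.2))
    (φ.continuous.comp continuous_circAct) (M := ‖φ‖) fun _ => φ.norm_coe_le_norm _

/-- Finitely many test functions detect uniformly that no pair of measures on the circle
is matched by almost every matrix. -/
theorem exists_test_functions {K : Set (ProbabilityMeasure (SL 2))} (hK : IsCompact K)
    {γ C : ℝ} (hγ : 0 < γ) (hmom : ∀ μ ∈ K, FiniteMomentCondition γ C μ)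
    (hmeas : ∀ μ ∈ K, MeasuresCondition μ) :
    ∃ (t : Finset C(Circ, ℝ)) (c : ℝ), 0 < c ∧ ∀ μ ∈ K, ∀ ν₁ ν₂ : ProbabilityMeasure Circ,
      c ≤ ∑ φ ∈ t, ∫ A, (∫ s, φ (circAct A s) ∂(ν₁ : Measure Circ) -
        ∫ s, φ s ∂(ν₂ : Measure Circ)) ^ 2 ∂(μ : Measure (SL 2)) := by
  have : CompactSpace K := isCompact_iff_compactSpace.1 hK
  let g : C(Circ, ℝ) → (ProbabilityMeasure Circ × ProbabilityMeasure Circ) × SL 2 → ℝ :=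
    fun φ p => (∫ s, φ (circAct p.2 s) ∂(p.1.1 : Measure Circ) -
        ∫ s, φ s ∂(p.1.2 : Measure Circ)) ^ 2
  have hg : ∀ φ, Continuous (g φ) := by
    intro φ
    have h1 := (continuous_integral_circAct φ).comp
      (f := fun p : (ProbabilityMeasure Circ × ProbabilityMeasure Circ) × SL 2 => (p.2, p.1.1))
      (by fun_prop)
    have h2 := (continuous_integral_of_compactSpace
      (h := fun q : Unit × Circ => φ q.2) (φ.continuous.comp continuous_snd) (M := ‖φ‖)
      fun p => φ.norm_coe_le_norm _).comp
      (f := fun p : (ProbabilityMeasure Circ × ProbabilityMeasure Circ) × SL 2 => ((), p.1.2))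
      (by fun_prop)
    exact (h1.sub h2).pow 2
  have hb : ∀ φ p, |g φ p| ≤ (2 * ‖φ‖) ^ 2 := by
    intro φ p
    have h1 := abs_integral_continuousMap_le p.1.1 (circAct p.2) φ
    have h2 := abs_integral_continuousMap_le p.1.2 id φ
    rw [abs_of_nonneg (sq_nonneg _)]
    apply sq_le_sq'
    · have := (abs_le.1 h1).1; have := (abs_le.1 h2).2; simp only [id] at *; linarith
    · have := (abs_le.1 h1).2; have := (abs_le.1 h2).1; simp only [id] at *; linarith
  let J : C(Circ, ℝ) → (ProbabilityMeasure Circ × ProbabilityMeasure Circ) × K → ℝ :=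
    fun φ p => ∫ A, g φ (p.1, A) ∂((p.2 : ProbabilityMeasure (SL 2)) : Measure (SL 2))
  have hJ : ∀ φ, Continuous (J φ) := fun φ =>
    continuous_integral_of_tight continuous_subtype_val (tight_of_finiteMoment hγ hmom)
      (hg φ) (hb φ)
  have hJ0 : ∀ φ p, 0 ≤ J φ p := fun φ p => integral_nonneg fun A => sq_nonneg _
  have hpos : ∀ p, ∃ φ, 0 < J φ p := by
    rintro ⟨⟨ν₁, ν₂⟩, μ, hμ⟩
    by_contra! hcon
    apply (hmeas μ hμ).not_ae_map_circAct ν₁ ν₂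
    have hz : ∀ φ, ∀ᵐ A ∂(μ : Measure (SL 2)), g φ ((ν₁, ν₂), A) = 0 := by
      intro φ
      have h0 : J φ ((ν₁, ν₂), ⟨μ, hμ⟩) = 0 := le_antisymm (hcon φ) (hJ0 φ _)
      refine (integral_eq_zero_iff_of_nonneg (fun A => sq_nonneg _) ?_).1 h0
      exact Integrable.of_bound
        ((hg φ).comp (Continuous.prodMk_right _)).measurable.aestronglyMeasurable _
        (Eventually.of_forall fun a => hb φ _)
    obtain ⟨D, hDc, hDd⟩ := TopologicalSpace.exists_countable_dense C(Circ, ℝ)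
    have hz' : ∀ᵐ A ∂(μ : Measure (SL 2)), ∀ φ ∈ D, g φ ((ν₁, ν₂), A) = 0 :=
      (ae_ball_iff hDc).2 fun φ _ => hz φ
    filter_upwards [hz'] with A hA
    have hmA := measurable_circAct A
    have : IsProbabilityMeasure ((ν₁ : Measure Circ).map (circAct A)) :=
      Measure.isProbabilityMeasure_map hmA.aemeasurable
    have hall : ∀ φ : C(Circ, ℝ), ∫ s, φ (circAct A s) ∂(ν₁ : Measure Circ) -
        ∫ s, φ s ∂(ν₂ : Measure Circ) = 0 := by
      have hcl : IsClosed {φ : C(Circ, ℝ) | ∫ s, φ (circAct A s) ∂(ν₁ : Measure Circ) -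
          ∫ s, φ s ∂(ν₂ : Measure Circ) = 0} := by
        refine isClosed_eq (Continuous.sub ?_ ?_) continuous_const
        · have hL : LipschitzWith 1 (fun φ : C(Circ, ℝ) =>
              ∫ s, φ (circAct A s) ∂(ν₁ : Measure Circ)) := by
            refine LipschitzWith.of_dist_le_mul fun φ ψ => ?_
            have hi : ∀ φ : C(Circ, ℝ), Integrable (fun s => φ (circAct A s))
                (ν₁ : Measure Circ) := fun φ => Integrable.of_bound
              (φ.continuous.measurable.comp hmA).aestronglyMeasurable ‖φ‖
              (Eventually.of_forall fun a => φ.norm_coe_le_norm _)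
            rw [Real.dist_eq, ← integral_sub (hi φ) (hi ψ), dist_eq_norm, NNReal.coe_one, one_mul]
            exact abs_integral_continuousMap_le ν₁ (circAct A) (φ - ψ)
          exact hL.continuous
        · have hL : LipschitzWith 1 (fun φ : C(Circ, ℝ) =>
              ∫ s, φ s ∂(ν₂ : Measure Circ)) := by
            refine LipschitzWith.of_dist_le_mul fun φ ψ => ?_
            have hi : ∀ φ : C(Circ, ℝ), Integrable (fun s => φ s)
                (ν₂ : Measure Circ) := fun φ => Integrable.of_bound
              φ.continuous.measurable.aestronglyMeasurable ‖φ‖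
              (Eventually.of_forall fun a => φ.norm_coe_le_norm _)
            rw [Real.dist_eq, ← integral_sub (hi φ) (hi ψ), dist_eq_norm, NNReal.coe_one, one_mul]
            exact abs_integral_continuousMap_le ν₂ id (φ - ψ)
          exact hL.continuous
      have hsub : closure D ⊆ _ := hcl.closure_subset_iff.2 fun φ hφ =>
        pow_eq_zero_iff (two_ne_zero) |>.1 (hA φ hφ)
      rw [hDd.closure_eq] at hsub
      exact fun φ => hsub (Set.mem_univ φ)
    apply ext_of_forall_integral_eq_of_IsFiniteMeasure
    intro f
    have := hall f.toContinuousMap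
    rw [integral_map hmA.aemeasurable f.continuous.measurable.aestronglyMeasurable]
    exact sub_eq_zero.1 this
  obtain ⟨t, ht⟩ := isCompact_univ.elim_finite_subcover (fun φ => {p | 0 < J φ p})
    (fun φ => isOpen_lt continuous_const (hJ φ))
    (fun p _ => Set.mem_iUnion.2 (hpos p))
  have hS : Continuous (fun p => ∑ φ ∈ t, J φ p) := continuous_finsetSum _ fun φ _ => hJ φ
  have hSpos : ∀ p, 0 < ∑ φ ∈ t, J φ p := by
    intro p
    obtain ⟨φ, hφ⟩ := Set.mem_iUnion.1 (ht (Set.mem_univ p))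
    obtain ⟨hφt, hφ⟩ := Set.mem_iUnion.1 hφ
    exact Finset.sum_pos' (fun φ _ => hJ0 φ p) ⟨φ, hφt, hφ⟩
  rcases isEmpty_or_nonempty ((ProbabilityMeasure Circ × ProbabilityMeasure Circ) × K) with he | he
  · exact ⟨t, 1, one_pos, fun μ hμ ν₁ ν₂ => (he.false ((ν₁, ν₂), ⟨μ, hμ⟩)).elim⟩
  · obtain ⟨p₀, -, hp₀⟩ := isCompact_univ.exists_isMinOn Set.univ_nonempty hS.continuousOn
    exact ⟨t, _, hSpos p₀, fun μ hμ ν₁ ν₂ =>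
      hp₀ (Set.mem_univ ((ν₁, ν₂), (⟨μ, hμ⟩ : K)))⟩

theorem integrable_mul_of_integrable_sq {X : Type*} [MeasurableSpace X] {m : Measure X}
    {f g : X → ℝ} (hf : Measurable f) (hg : Measurable g)
    (hf2 : Integrable (fun x => f x ^ 2) m) (hg2 : Integrable (fun x => g x ^ 2) m) :
    Integrable (fun x => f x * g x) m :=
  MemLp.integrable_mul (p := 2) (q := 2)
    ((memLp_two_iff_integrable_sq hf.aestronglyMeasurable).2 hf2)
    ((memLp_two_iff_integrable_sq hg.aestronglyMeasurable).2 hg2)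

theorem integrable_add_sq {X : Type*} [MeasurableSpace X] {m : Measure X}
    {f g : X → ℝ} (hf : Measurable f) (hg : Measurable g)
    (hf2 : Integrable (fun x => f x ^ 2) m) (hg2 : Integrable (fun x => g x ^ 2) m) (t : ℝ) :
    Integrable (fun x => (t * f x + g x) ^ 2) m ∧
      ∫ x, (t * f x + g x) ^ 2 ∂m =
        (∫ x, f x ^ 2 ∂m) * (t * t) + (2 * ∫ x, f x * g x ∂m) * t + ∫ x, g x ^ 2 ∂m := by
  have h := integrable_mul_of_integrable_sq hf hg hf2 hg2
  have e : (fun x => (t * f x + g x) ^ 2) =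
      fun x => (t * t) * f x ^ 2 + (2 * t) * (f x * g x) + g x ^ 2 := by ext1 x; ring
  have i1 := hf2.const_mul (t * t)
  have i2 := h.const_mul (2 * t)
  have i12 : Integrable (fun x => (t * t) * f x ^ 2 + (2 * t) * (f x * g x)) m := i1.add i2
  rw [e]
  refine ⟨i12.add hg2, ?_⟩
  rw [integral_add i12 hg2, integral_add i1 i2, integral_const_mul, integral_const_mul]
  ring

/-- The Cauchy-Schwarz inequality for real integrals. -/
theorem sq_integral_mul_le {X : Type*} [MeasurableSpace X] {m : Measure X}
    {f g : X → ℝ} (hf : Measurable f) (hg : Measurable g)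
    (hf2 : Integrable (fun x => f x ^ 2) m) (hg2 : Integrable (fun x => g x ^ 2) m) :
    (∫ x, f x * g x ∂m) ^ 2 ≤ (∫ x, f x ^ 2 ∂m) * ∫ x, g x ^ 2 ∂m := by
  have h : discrim (∫ x, f x ^ 2 ∂m) (2 * ∫ x, f x * g x ∂m) (∫ x, g x ^ 2 ∂m) ≤ 0 := by
    apply discrim_le_zero
    intro t
    rw [← (integrable_add_sq hf hg hf2 hg2 t).2]
    exact integral_nonneg fun x => sq_nonneg _
  rw [discrim] at h
  nlinarith

/-- A measure preserving action of `SL(2, ℝ)` lying over the action on directions. -/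
structure DirSystem (X : Type) [MeasurableSpace X] (m : Measure X) where
  /-- the action -/
  act : SL 2 → X → X
  act_mul : ∀ A B x, act (A * B) x = act A (act B x)
  act_one : ∀ x, act 1 x = x
  measurable_act : Measurable (fun p : SL 2 × X => act p.1 p.2)
  measurePreserving : ∀ A, MeasurePreserving (act A) m m
  /-- the projection to directions -/
  proj : X → Circ
  measurable_proj : Measurable proj
  proj_act : ∀ A, ∀ᵐ x ∂m, proj (act A x) = circAct A (proj x)

namespace DirSystem

variable {X : Type} [MeasurableSpace X] {m : Measure X} (S : DirSystem X m)

theorem measurable_act_inv : Measurable (fun p : SL 2 × X => S.act p.1⁻¹ p.2) :=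
  S.measurable_act.comp (measurable_fst.inv.prodMk measurable_snd)

theorem measurable_act_left (A : SL 2) : Measurable (S.act A) :=
  (S.measurePreserving A).measurable

theorem act_inv_act (A : SL 2) (x : X) : S.act A⁻¹ (S.act A x) = x := by
  rw [← S.act_mul, inv_mul_cancel, S.act_one]

theorem integrable_comp {f : X → ℝ} (hf : Integrable f m) (A : SL 2) :
    Integrable (fun x => f (S.act A x)) m :=
  (S.measurePreserving A).integrable_comp_of_integrable hf

theorem integral_comp {f : X → ℝ} (hf : Measurable f) (A : SL 2) :
    ∫ x, f (S.act A x) ∂m = ∫ x, f x ∂m := by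
  have h := (S.measurePreserving A).map_eq
  conv_rhs => rw [← h]
  rw [integral_map (S.measurable_act_left A).aemeasurable]
  exact hf.aestronglyMeasurable

/-- The distribution of directions under the density `f ^ 2`. -/
theorem exists_dirLaw {f : X → ℝ} (hf : Measurable f) (hf2 : Integrable (fun x => f x ^ 2) m)
    (h1 : ∫ x, f x ^ 2 ∂m = 1) :
    ∃ ν : ProbabilityMeasure Circ, ∀ φ : Circ → ℝ, Measurable φ →
      ∫ s, φ s ∂(ν : Measure Circ) = ∫ x, φ (S.proj x) * f x ^ 2 ∂m := by
  have hd : Measurable (fun x => ENNReal.ofReal (f x ^ 2)) := (hf.pow_const 2).ennreal_ofReal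
  have hp : IsProbabilityMeasure (m.withDensity fun x => ENNReal.ofReal (f x ^ 2)) := by
    constructor
    rw [withDensity_apply _ MeasurableSet.univ, Measure.restrict_univ,
      ← ofReal_integral_eq_lintegral_ofReal hf2 (Eventually.of_forall fun x => sq_nonneg _), h1,
      ENNReal.ofReal_one]
  refine ⟨⟨(m.withDensity fun x => ENNReal.ofReal (f x ^ 2)).map S.proj,
    Measure.isProbabilityMeasure_map S.measurable_proj.aemeasurable⟩, fun φ hφ => ?_⟩
  rw [ProbabilityMeasure.coe_mk, integral_map S.measurable_proj.aemeasurable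
    hφ.aestronglyMeasurable, integral_withDensity_eq_integral_toReal_smul hd
    (Eventually.of_forall fun x => ENNReal.ofReal_lt_top)]
  congr 1
  ext1 x
  rw [ENNReal.toReal_ofReal (sq_nonneg _), smul_eq_mul, mul_comm]

theorem sq_sub_le {f g : X → ℝ} (hf : Measurable f) (hg : Measurable g)
    (hf2 : Integrable (fun x => f x ^ 2) m) (hg2 : Integrable (fun x => g x ^ 2) m)
    (hf1 : ∫ x, f x ^ 2 ∂m = 1) (hg1 : ∫ x, g x ^ 2 ∂m = 1) {ν₁ ν₂ : ProbabilityMeasure Circ}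
    (h₁ : ∀ φ : Circ → ℝ, Measurable φ →
      ∫ s, φ s ∂(ν₁ : Measure Circ) = ∫ x, φ (S.proj x) * f x ^ 2 ∂m)
    (h₂ : ∀ φ : Circ → ℝ, Measurable φ →
      ∫ s, φ s ∂(ν₂ : Measure Circ) = ∫ x, φ (S.proj x) * g x ^ 2 ∂m)
    (φ : C(Circ, ℝ)) (A : SL 2) :
    |∫ x, f (S.act A⁻¹ x) * g x ∂m| ≤ 1 ∧
    (∫ s, φ (circAct A s) ∂(ν₁ : Measure Circ) - ∫ s, φ s ∂(ν₂ : Measure Circ)) ^ 2 ≤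
      8 * ‖φ‖ ^ 2 * (1 - ∫ x, f (S.act A⁻¹ x) * g x ∂m) := by
  have hφ : Measurable φ := φ.continuous.measurable
  set u : X → ℝ := fun x => f (S.act A⁻¹ x) with hu
  have hum : Measurable u := hf.comp (S.measurable_act_left A⁻¹)
  have hu2 : Integrable (fun x => u x ^ 2) m := S.integrable_comp hf2 A⁻¹
  have hu1 : ∫ x, u x ^ 2 ∂m = 1 := by
    rw [← hf1]; exact S.integral_comp (hf.pow_const 2) A⁻¹
  set h := ∫ x, u x * g x ∂m with hh
  have hcs := sq_integral_mul_le hum hg hu2 hg2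
  rw [hu1, hg1, one_mul, ← hh] at hcs
  have habs : |h| ≤ 1 := by rwa [sq_le_one_iff_abs_le_one] at hcs
  refine ⟨habs, ?_⟩
  have e1 : ∫ s, φ (circAct A s) ∂(ν₁ : Measure Circ) = ∫ x, φ (S.proj x) * u x ^ 2 ∂m := by
    rw [h₁ (fun s => φ (circAct A s)) (hφ.comp (measurable_circAct A)),
      ← S.integral_comp (f := fun x => φ (S.proj x) * u x ^ 2)
        ((hφ.comp S.measurable_proj).mul (hum.pow_const 2)) A]
    apply integral_congr_ae
    filter_upwards [S.proj_act A] with x hx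
    simp only [hx, hu, S.act_inv_act]
  have hi : ∀ k : X → ℝ, Integrable k m → Integrable (fun x => φ (S.proj x) * k x) m :=
    fun k hk => hk.bdd_mul (hφ.comp S.measurable_proj).aestronglyMeasurable
      (Eventually.of_forall fun x => φ.norm_coe_le_norm _)
  rw [e1, h₂ φ hφ, ← integral_sub (hi _ hu2) (hi _ hg2)]
  have ha := integrable_add_sq hum hg hu2 hg2 1
  have hb := integrable_add_sq hum hg hu2 hg2 (-1)
  rw [hu1, hg1, ← hh] at ha hb
  set a : X → ℝ := fun x => φ (S.proj x) * (1 * u x + g x) with hadef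
  set b : X → ℝ := fun x => (-1) * u x + g x with hbdef
  have hab : (fun x => φ (S.proj x) * u x ^ 2 - φ (S.proj x) * g x ^ 2) =
      fun x => - (a x * b x) := by ext1 x; simp only [hadef, hbdef]; ring
  have ham : Measurable a := (hφ.comp S.measurable_proj).mul ((hum.const_mul 1).add hg)
  have hbm : Measurable b := (hum.const_mul _).add hg
  have hale : ∀ x, a x ^ 2 ≤ ‖φ‖ ^ 2 * (1 * u x + g x) ^ 2 := by
    intro x
    simp only [hadef, mul_pow]
    have := φ.norm_coe_le_norm (S.proj x)
    rw [Real.norm_eq_abs] at this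
    gcongr ?_ * _
    rw [← sq_abs]
    gcongr
  have ha2 : Integrable (fun x => a x ^ 2) m :=
    (ha.1.const_mul (‖φ‖ ^ 2)).mono' (ham.pow_const 2).aestronglyMeasurable
      (Eventually.of_forall fun x => by
        rw [Real.norm_of_nonneg (sq_nonneg _)]; exact hale x)
  have haI : ∫ x, a x ^ 2 ∂m ≤ ‖φ‖ ^ 2 * (2 + 2 * h) := by
    calc ∫ x, a x ^ 2 ∂m ≤ ∫ x, ‖φ‖ ^ 2 * (1 * u x + g x) ^ 2 ∂m :=
          integral_mono ha2 (ha.1.const_mul _) hale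
      _ = _ := by rw [integral_const_mul, ha.2]; ring
  have hbI : ∫ x, b x ^ 2 ∂m = 2 - 2 * h := by rw [hb.2]; ring
  have hfin := sq_integral_mul_le ham hbm ha2 hb.1
  rw [hab, integral_neg, neg_sq]
  obtain ⟨hl, hr⟩ := abs_le.1 habs
  calc (∫ x, a x * b x ∂m) ^ 2 ≤ _ := hfin
    _ ≤ (‖φ‖ ^ 2 * (2 + 2 * h)) * (2 - 2 * h) := by
        rw [hbI]; gcongr; linarith
    _ = 4 * ‖φ‖ ^ 2 * (1 + h) * (1 - h) := by ring
    _ ≤ 4 * ‖φ‖ ^ 2 * 2 * (1 - h) := by gcongr; linarith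
    _ = _ := by ring

theorem stronglyMeasurable_integral {f g : X → ℝ} (hf : Measurable f) (hg : Measurable g)
    (hg2 : Integrable (fun x => g x ^ 2) m) :
    StronglyMeasurable (fun A => ∫ x, f (S.act A⁻¹ x) * g x ∂m) := by
  obtain ⟨t, ht, htg, hts⟩ := hg2.aefinStronglyMeasurable.exists_set_sigmaFinite
  have e : (fun A => ∫ x, f (S.act A⁻¹ x) * g x ∂m) =
      fun A => ∫ x in t, f (S.act A⁻¹ x) * g x ∂m := by
    ext1 A
    rw [setIntegral_eq_integral_of_ae_compl_eq_zero]
    filter_upwards [(ae_restrict_iff' ht.compl).1 htg] with x hx hxt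
    have := hx hxt
    simp only [Pi.zero_apply, pow_eq_zero_iff two_ne_zero] at this
    rw [this, mul_zero]
  rw [e]
  apply StronglyMeasurable.integral_prod_right
    (f := fun (A : SL 2) (x : X) => f (S.act A⁻¹ x) * g x)
  exact ((hf.comp S.measurable_act_inv).mul (hg.comp measurable_snd)).stronglyMeasurable

end DirSystem

theorem exists_gap {K : Set (ProbabilityMeasure (SL 2))} (hK : IsCompact K)
    {γ C : ℝ} (hγ : 0 < γ) (hmom : ∀ μ ∈ K, FiniteMomentCondition γ C μ)
    (hmeas : ∀ μ ∈ K, MeasuresCondition μ) :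
    ∃ ρ : ℝ, 0 < ρ ∧ ρ < 1 ∧ ∀ μ ∈ K, ∀ (X : Type) [MeasurableSpace X] (m : Measure X)
      (S : DirSystem X m) (f g : X → ℝ), Measurable f → Measurable g →
      Integrable (fun x => f x ^ 2) m → Integrable (fun x => g x ^ 2) m →
      ∫ A, (∫ x, f (S.act A⁻¹ x) * g x ∂m) ∂(μ : Measure (SL 2)) ≤
        ρ * (√(∫ x, f x ^ 2 ∂m) * √(∫ x, g x ^ 2 ∂m)) := by
  obtain ⟨t, c, hc, htc⟩ := exists_test_functions hK hγ hmom hmeas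
  set s := ∑ φ ∈ t, 8 * ‖φ‖ ^ 2 with hs
  have hs0 : 0 ≤ s := Finset.sum_nonneg fun φ _ => by positivity
  have hfrac : c / (s + 2 * c) < 1 := by rw [div_lt_one (by positivity)]; linarith
  refine ⟨1 - c / (s + 2 * c), by linarith, by linarith [show 0 < c / (s + 2 * c) by positivity],
    fun μ hμ X _ m S => ?_⟩
  have key : ∀ f g : X → ℝ, Measurable f → Measurable g →
      Integrable (fun x => f x ^ 2) m → Integrable (fun x => g x ^ 2) m →
      ∫ x, f x ^ 2 ∂m = 1 → ∫ x, g x ^ 2 ∂m = 1 →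
      ∫ A, (∫ x, f (S.act A⁻¹ x) * g x ∂m) ∂(μ : Measure (SL 2)) ≤ 1 - c / (s + 2 * c) := by
    intro f g hf hg hf2 hg2 hf1 hg1
    obtain ⟨ν₁, h₁⟩ := S.exists_dirLaw hf hf2 hf1
    obtain ⟨ν₂, h₂⟩ := S.exists_dirLaw hg hg2 hg1
    have hle := S.sq_sub_le hf hg hf2 hg2 hf1 hg1 h₁ h₂
    set h : SL 2 → ℝ := fun A => ∫ x, f (S.act A⁻¹ x) * g x ∂m with hh
    have hi : Integrable h (μ : Measure (SL 2)) := Integrable.of_bound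
      (S.stronglyMeasurable_integral hf hg hg2).aestronglyMeasurable 1
      (Eventually.of_forall fun A => (hle 0 A).1)
    set H := ∫ A, h A ∂(μ : Measure (SL 2)) with hH
    have hH1 : H ≤ 1 := by
      calc H ≤ ∫ _, (1 : ℝ) ∂(μ : Measure (SL 2)) :=
            integral_mono hi (integrable_const _) fun A => (abs_le.1 (hle 0 A).1).2
        _ = 1 := by simp
    have h3 : c ≤ s * (1 - H) := by
      refine (htc μ hμ ν₁ ν₂).trans ?_
      rw [hs, Finset.sum_mul]
      refine Finset.sum_le_sum fun φ _ => ?_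
      have hi' : Integrable (fun A => 8 * ‖φ‖ ^ 2 * (1 - h A)) (μ : Measure (SL 2)) :=
        ((integrable_const _).sub hi).const_mul _
      calc _ ≤ ∫ A, 8 * ‖φ‖ ^ 2 * (1 - h A) ∂(μ : Measure (SL 2)) :=
            integral_mono_of_nonneg (Eventually.of_forall fun A => sq_nonneg _) hi'
              (Eventually.of_forall fun A => (hle φ A).2)
        _ = _ := by
            rw [integral_const_mul, integral_sub (integrable_const _) hi]; simp [hH]
    have h4 : c / (s + 2 * c) ≤ 1 - H := by
      rw [div_le_iff₀ (by positivity)]; nlinarith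
    linarith
  intro f g hf hg hf2 hg2
  have hzero : (∫ x, f x ^ 2 ∂m) * (∫ x, g x ^ 2 ∂m) = 0 →
      ∫ A, (∫ x, f (S.act A⁻¹ x) * g x ∂m) ∂(μ : Measure (SL 2)) = 0 := by
    intro h0
    have : ∀ A, ∫ x, f (S.act A⁻¹ x) * g x ∂m = 0 := by
      intro A
      have h1 := sq_integral_mul_le (f := fun x => f (S.act A⁻¹ x))
        (hf.comp (S.measurable_act_left A⁻¹)) hg (S.integrable_comp hf2 A⁻¹) hg2
      rw [S.integral_comp (f := fun x => f x ^ 2) (hf.pow_const 2), h0] at h1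
      exact pow_eq_zero_iff two_ne_zero |>.1 (le_antisymm h1 (sq_nonneg _))
    simp [this]
  have hf0 : 0 ≤ ∫ x, f x ^ 2 ∂m := integral_nonneg fun x => sq_nonneg _
  have hg0 : 0 ≤ ∫ x, g x ^ 2 ∂m := integral_nonneg fun x => sq_nonneg _
  by_cases hz : (∫ x, f x ^ 2 ∂m) * (∫ x, g x ^ 2 ∂m) = 0
  · rw [hzero hz]
    have : 0 ≤ 1 - c / (s + 2 * c) := by linarith
    positivity
  · have hfp : 0 < ∫ x, f x ^ 2 ∂m := lt_of_le_of_ne hf0 (Ne.symm (left_ne_zero_of_mul hz))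
    have hgp : 0 < ∫ x, g x ^ 2 ∂m := lt_of_le_of_ne hg0 (Ne.symm (right_ne_zero_of_mul hz))
    set a := √(∫ x, f x ^ 2 ∂m) with ha
    set b := √(∫ x, g x ^ 2 ∂m) with hb
    have ha0 : 0 < a := Real.sqrt_pos.2 hfp
    have hb0 : 0 < b := Real.sqrt_pos.2 hgp
    have ha2 : a ^ 2 = ∫ x, f x ^ 2 ∂m := Real.sq_sqrt hf0
    have hb2 : b ^ 2 = ∫ x, g x ^ 2 ∂m := Real.sq_sqrt hg0
    have h5 := key (fun x => a⁻¹ * f x) (fun x => b⁻¹ * g x) (hf.const_mul _) (hg.const_mul _)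
      (by simp only [mul_pow]; exact hf2.const_mul _) (by simp only [mul_pow]; exact hg2.const_mul _)
      (by simp only [mul_pow]; rw [integral_const_mul, ← ha2]; field_simp)
      (by simp only [mul_pow]; rw [integral_const_mul, ← hb2]; field_simp)
    have e : ∀ A : SL 2, ∫ x, a⁻¹ * f (S.act A⁻¹ x) * (b⁻¹ * g x) ∂m =
        (a * b)⁻¹ * ∫ x, f (S.act A⁻¹ x) * g x ∂m := by
      intro A
      rw [← integral_const_mul]
      congr 1; ext1 x; field_simp
    simp only [e] at h5
    rw [integral_const_mul, inv_mul_le_iff₀ (by positivity)] at h5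
    linarith

/-- The law of the product of the first `n` matrices. -/
def lawT (m : ℕ → ProbabilityMeasure (SL 2)) : ℕ → Measure (SL 2)
  | 0 => Measure.dirac 1
  | n + 1 => Measure.mconv (m n : Measure (SL 2)) (lawT m n)

instance (m : ℕ → ProbabilityMeasure (SL 2)) (n : ℕ) : IsProbabilityMeasure (lawT m n) := by
  induction n with
  | zero => exact inferInstanceAs (IsProbabilityMeasure (Measure.dirac 1))
  | succ n ih =>
    exact inferInstanceAs (IsProbabilityMeasure (Measure.mconv (m n : Measure (SL 2)) (lawT m n)))

theorem mconv_real_apply (μ ν : Measure (SL 2)) [IsProbabilityMeasure μ] [IsProbabilityMeasure ν]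
    {s : Set (SL 2)} (hs : MeasurableSet s) :
    (Measure.mconv μ ν).real s = ∫ a, ν.real {b | a * b ∈ s} ∂μ := by
  have h1 : MeasurableSet ((fun p : SL 2 × SL 2 => p.1 * p.2) ⁻¹' s) := measurable_mul hs
  have h2 : Measurable fun a => ν {b | a * b ∈ s} := measurable_measure_prodMk_left h1
  rw [Measure.real, Measure.mconv, Measure.map_apply measurable_mul hs, Measure.prod_apply h1]
  exact (integral_toReal h2.aemeasurable (Eventually.of_forall fun a => measure_lt_top _ _)).symm

namespace DirSystem

variable {X : Type} [MeasurableSpace X] {m : Measure X} (S : DirSystem X m)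

/-- The probability that the random product has moved a point of `B` to `x`. -/
def hit (μ : ℕ → ProbabilityMeasure (SL 2)) (B : Set X) (n : ℕ) (x : X) : ℝ :=
  (lawT μ n).real {A | S.act A⁻¹ x ∈ B}

variable {μ : ℕ → ProbabilityMeasure (SL 2)} {B : Set X}

theorem hit_nonneg (n : ℕ) (x : X) : 0 ≤ S.hit μ B n x := measureReal_nonneg

theorem hit_le_one (n : ℕ) (x : X) : S.hit μ B n x ≤ 1 := measureReal_le_one

theorem measurable_hit (hB : MeasurableSet B) (n : ℕ) : Measurable (S.hit μ B n) := by
  have h : MeasurableSet {p : X × SL 2 | S.act p.2⁻¹ p.1 ∈ B} :=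
    (S.measurable_act_inv.comp measurable_swap) hB
  exact (measurable_measure_prodMk_left (ν := lawT μ n) h).ennreal_toReal

theorem hit_zero (x : X) : S.hit μ B 0 x = B.indicator 1 x := by
  rw [hit, lawT, Measure.real, Measure.dirac_apply]
  by_cases hx : x ∈ B
  · simp [S.act_one, hx]
  · simp [S.act_one, hx]

theorem hit_succ (hB : MeasurableSet B) (n : ℕ) (x : X) :
    S.hit μ B (n + 1) x = ∫ a, S.hit μ B n (S.act a⁻¹ x) ∂(μ n : Measure (SL 2)) := by
  have h : MeasurableSet {A | S.act A⁻¹ x ∈ B} :=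
    (S.measurable_act_inv.comp (measurable_id.prodMk measurable_const)) hB
  rw [hit, lawT, mconv_real_apply _ _ h]
  simp only [hit, Set.mem_ofPred_eq, _root_.mul_inv_rev, S.act_mul]

theorem integral_hit_succ_mul (hB : MeasurableSet B) (n : ℕ) {g : X → ℝ} (hg : Measurable g)
    (hgi : Integrable g m) :
    ∫ x, S.hit μ B (n + 1) x * g x ∂m =
      ∫ a, (∫ x, S.hit μ B n (S.act a⁻¹ x) * g x ∂m) ∂(μ n : Measure (SL 2)) := by
  obtain ⟨t, ht, htg, hts⟩ := hgi.aefinStronglyMeasurable.exists_set_sigmaFinite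
  have e : ∀ u : X → ℝ, ∫ x, u x * g x ∂m = ∫ x in t, u x * g x ∂m := by
    intro u
    rw [setIntegral_eq_integral_of_ae_compl_eq_zero]
    filter_upwards [(ae_restrict_iff' ht.compl).1 htg] with x hx hxt
    rw [hx hxt, Pi.zero_apply, mul_zero]
  simp only [e]
  rw [integral_integral_swap]
  · congr 1
    ext1 x
    rw [S.hit_succ hB, integral_mul_const]
  · have hb : Integrable (fun p : SL 2 × X => g p.2)
        ((μ n : Measure (SL 2)).prod (m.restrict t)) := hgi.restrict.comp_snd _
    refine hb.norm.mono' ?_ (Eventually.of_forall fun p => ?_)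
    · exact (((S.measurable_hit hB n).comp S.measurable_act_inv).mul
        (hg.comp measurable_snd)).aestronglyMeasurable
    · rw [Function.uncurry, norm_mul, Real.norm_of_nonneg (S.hit_nonneg _ _)]
      exact mul_le_of_le_one_left (norm_nonneg _) (S.hit_le_one _ _)

theorem integrable_hit_sq (hB : MeasurableSet B) (n : ℕ) (h : Integrable (S.hit μ B n) m) :
    Integrable (fun x => S.hit μ B n x ^ 2) m :=
  h.mono' ((S.measurable_hit hB n).pow_const 2).aestronglyMeasurable
    (Eventually.of_forall fun x => by
      rw [Real.norm_of_nonneg (sq_nonneg _)]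
      nlinarith [S.hit_nonneg (μ := μ) (B := B) n x, S.hit_le_one (μ := μ) (B := B) n x])

/-- The gap estimate makes the hitting probabilities decay exponentially in `L²`. -/
theorem sqrt_integral_hit_sq_le {ρ : ℝ} (hρ : 0 ≤ ρ) (hB : MeasurableSet B)
    (hgap : ∀ (i : ℕ) (f g : X → ℝ), Measurable f → Measurable g →
      Integrable (fun x => f x ^ 2) m → Integrable (fun x => g x ^ 2) m →
      ∫ A, (∫ x, f (S.act A⁻¹ x) * g x ∂m) ∂(μ i : Measure (SL 2)) ≤
        ρ * (√(∫ x, f x ^ 2 ∂m) * √(∫ x, g x ^ 2 ∂m)))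
    (hint : ∀ n, Integrable (S.hit μ B n) m) (n : ℕ) :
    √(∫ x, S.hit μ B n x ^ 2 ∂m) ≤ ρ ^ n * √(m.real B) := by
  induction n with
  | zero =>
    have e : (fun x => S.hit μ B 0 x ^ 2) = B.indicator 1 := by
      ext1 x
      rw [S.hit_zero]
      by_cases hx : x ∈ B <;> simp [hx]
    rw [e, integral_indicator_one hB, pow_zero, one_mul]
  | succ n ih =>
    have hm := S.measurable_hit (μ := μ) hB
    have hsq := fun k => S.integrable_hit_sq hB k (hint k)
    have h1 := hgap n _ _ (hm n) (hm (n + 1)) (hsq n) (hsq (n + 1))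
    rw [← S.integral_hit_succ_mul hB n (hm (n + 1)) (hint (n + 1))] at h1
    simp only [← sq] at h1
    set q := √(∫ x, S.hit μ B (n + 1) x ^ 2 ∂m) with hq
    have hq2 : q ^ 2 = ∫ x, S.hit μ B (n + 1) x ^ 2 ∂m :=
      Real.sq_sqrt (integral_nonneg fun x => sq_nonneg _)
    rw [← hq2] at h1
    have hq0 : 0 ≤ q := Real.sqrt_nonneg _
    rcases hq0.eq_or_lt with h0 | h0
    · rw [← h0]; positivity
    · have h2 : q ≤ ρ * √(∫ x, S.hit μ B n x ^ 2 ∂m) := by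
        apply le_of_mul_le_mul_right _ h0
        linarith
      calc q ≤ _ := h2
        _ ≤ ρ * (ρ ^ n * √(m.real B)) := by gcongr
        _ = _ := by ring

end DirSystem

theorem det_toEuclideanCLM (A : Matrix (Fin 2) (Fin 2) ℝ) :
    LinearMap.det ((Matrix.toEuclideanCLM (𝕜 := ℝ) A :
      EuclideanSpace ℝ (Fin 2) →L[ℝ] EuclideanSpace ℝ (Fin 2)) :
      EuclideanSpace ℝ (Fin 2) →ₗ[ℝ] EuclideanSpace ℝ (Fin 2)) = A.det := by
  rw [Matrix.coe_toEuclideanCLM_eq_toEuclideanLin]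
  change LinearMap.det (Matrix.toLpLin 2 2 A) = A.det
  rw [Matrix.toLpLin_eq_toLin, LinearMap.det_toLin]

theorem measurePreserving_slVec (A : SL 2) :
    MeasurePreserving (slVec A) (volume : Measure (EuclideanSpace ℝ (Fin 2))) volume := by
  refine ⟨(continuous_slVec.comp (Continuous.prodMk_right A)).measurable, ?_⟩
  have hdet : LinearMap.det ((Matrix.toEuclideanCLM (𝕜 := ℝ) (A : Matrix (Fin 2) (Fin 2) ℝ) :
      EuclideanSpace ℝ (Fin 2) →L[ℝ] EuclideanSpace ℝ (Fin 2)) :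
      EuclideanSpace ℝ (Fin 2) →ₗ[ℝ] EuclideanSpace ℝ (Fin 2)) = 1 := by
    rw [det_toEuclideanCLM]; exact A.2
  have h := Measure.map_linearMap_addHaar_eq_smul_addHaar
    (volume : Measure (EuclideanSpace ℝ (Fin 2))) (by rw [hdet]; exact one_ne_zero)
  rw [hdet] at h
  simp only [inv_one, abs_one, ENNReal.ofReal_one, one_smul] at h
  exact h

/-- The action on the plane, with Lebesgue measure. -/
def planeSystem : DirSystem (EuclideanSpace ℝ (Fin 2)) volume where
  act := slVec
  act_mul := slVec_mul
  act_one := slVec_one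
  measurable_act := continuous_slVec.measurable
  measurePreserving := measurePreserving_slVec
  proj := dir
  measurable_proj := measurable_dir
  proj_act A := by
    have h : ∀ᵐ x ∂(volume : Measure (EuclideanSpace ℝ (Fin 2))), x ∈ ({0} : Set _)ᶜ :=
      compl_mem_ae_iff.2 (measure_singleton 0)
    filter_upwards [h] with x hx
    exact dir_slVec A hx

theorem bijective_circAct (A : SL 2) : Function.Bijective (circAct A) :=
  Function.bijective_iff_has_inverse.2 ⟨circAct A⁻¹,
    fun x => by rw [← circAct_mul, inv_mul_cancel, circAct_one],
    fun x => by rw [← circAct_mul, mul_inv_cancel, circAct_one]⟩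

/-- The action on the circle of directions, with counting measure. -/
def circSystem : DirSystem Circ Measure.count where
  act := circAct
  act_mul := circAct_mul
  act_one := circAct_one
  measurable_act := continuous_circAct.measurable
  measurePreserving A := by
    refine ⟨measurable_circAct A, ?_⟩
    ext s hs
    rw [Measure.map_apply (measurable_circAct A) hs, Measure.count_apply hs,
      Measure.count_apply (measurable_circAct A hs),
      Set.encard_preimage_of_bijective (bijective_circAct A)]
  proj := id
  measurable_proj := measurable_id
  proj_act _ := Eventually.of_forall fun _ => rfl

section Decay

variable {K : Set (ProbabilityMeasure (SL 2))} {γ C : ℝ}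

/-- The probability that the random product maps one given direction to another
decays exponentially. -/
theorem exists_decay (hK : IsCompact K) (hγ : 0 < γ)
    (hmom : ∀ μ ∈ K, FiniteMomentCondition γ C μ) (hmeas : ∀ μ ∈ K, MeasuresCondition μ) :
    ∃ ρ : ℝ, 0 < ρ ∧ ρ < 1 ∧ ∀ m : ℕ → ProbabilityMeasure (SL 2), (∀ i, m i ∈ K) → ∀ n,
      (∀ x y : Circ, (lawT m n).real {A | circAct A y = x} ≤ ρ ^ n) ∧
      ∫ A, (slNorm A ^ 2)⁻¹ ∂(lawT m n) ≤ ρ ^ n := by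
  obtain ⟨ρ, hρ0, hρ1, hgap⟩ := exists_gap hK hγ hmom hmeas
  refine ⟨ρ, hρ0, hρ1, fun m hm n => ⟨fun x y => ?_, ?_⟩⟩
  · have hB : MeasurableSet ({y} : Set Circ) := measurableSet_singleton y
    have hint : ∀ k, Integrable (circSystem.hit m {y} k) Measure.count := by
      intro k
      rw [integrable_count_iff]
      refine Summable.norm ?_
      refine summable_of_sum_le (c := 1) (fun x => circSystem.hit_nonneg k x) fun u => ?_
      have hmeas : ∀ x : Circ, MeasurableSet {A : SL 2 | circAct A⁻¹ x ∈ ({y} : Set Circ)} :=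
        fun x => (circSystem.measurable_act_inv.comp
          (measurable_id.prodMk (measurable_const (a := x)))) hB
      calc ∑ x ∈ u, circSystem.hit m {y} k x
          = (lawT m k).real (⋃ x ∈ u, {A : SL 2 | circAct A⁻¹ x ∈ ({y} : Set Circ)}) := by
            rw [measureReal_biUnion_finset]
            · rfl
            · intro x _ x' _ hxx'
              rw [Function.onFun, Set.disjoint_left]
              intro A hA hA'
              exact hxx' ((bijective_circAct A⁻¹).1 (Eq.trans hA (Eq.symm hA')))
            · exact fun x _ => hmeas x
        _ ≤ 1 := measureReal_le_one
    have h1 := circSystem.sqrt_integral_hit_sq_le hρ0.le hB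
      (fun i f g => hgap _ (hm i) Circ Measure.count circSystem f g) hint n
    have hsq := circSystem.integrable_hit_sq hB n (hint n)
    have h2 : circSystem.hit m {y} n x ^ 2 ≤
        ∫ z, circSystem.hit m {y} n z ^ 2 ∂(Measure.count : Measure Circ) := by
      have := setIntegral_le_integral (s := {x}) hsq (Eventually.of_forall fun z => sq_nonneg _)
      rwa [Measure.restrict_singleton, integral_smul_measure, integral_dirac,
        Measure.count_singleton, ENNReal.toReal_one, one_smul] at this
    have h3 : circSystem.hit m {y} n x ≤ ρ ^ n := by
      refine (Real.le_sqrt_of_sq_le h2).trans (h1.trans ?_)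
      simp [Measure.real]
    refine le_trans (le_of_eq ?_) h3
    rw [DirSystem.hit]
    congr 1
    ext A
    simp only [Set.mem_ofPred_eq, Set.mem_singleton_iff]
    constructor
    · rintro rfl
      exact circSystem.act_inv_act A y
    · rintro rfl
      change circAct A (circAct A⁻¹ x) = x
      rw [← circAct_mul, mul_inv_cancel, circAct_one]
  · set E := EuclideanSpace ℝ (Fin 2)
    set B : Set E := Metric.closedBall 0 1 with hBdef
    have hB : MeasurableSet B := Metric.isClosed_closedBall.measurableSet
    have hBfin : (volume : Measure E) B ≠ ∞ := measure_closedBall_lt_top.ne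
    have hBpos : 0 < (volume : Measure E).real B :=
      ENNReal.toReal_pos (Metric.measure_closedBall_pos _ _ one_pos).ne' hBfin
    have hset : MeasurableSet {p : E × SL 2 | slVec p.2⁻¹ p.1 ∈ B} :=
      (planeSystem.measurable_act_inv.comp measurable_swap) hB
    have hint : ∀ k, Integrable (planeSystem.hit m B k) volume := by
      intro k
      refine ⟨(planeSystem.measurable_hit hB k).aestronglyMeasurable, ?_⟩
      rw [hasFiniteIntegral_iff_ofReal (Eventually.of_forall fun x => planeSystem.hit_nonneg k x)]
      have e : ∀ x, ENNReal.ofReal (planeSystem.hit m B k x) =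
          lawT m k {A | slVec A⁻¹ x ∈ B} := fun x => by
        rw [DirSystem.hit, ofReal_measureReal]; rfl
      simp only [e]
      have h1 := Measure.prod_apply (μ := (volume : Measure E)) (ν := lawT m k) hset
      have h2 := Measure.prod_apply_symm (μ := (volume : Measure E)) (ν := lawT m k) hset
      change ∫⁻ x, lawT m k (Prod.mk x ⁻¹' {p : E × SL 2 | slVec p.2⁻¹ p.1 ∈ B}) < ∞
      rw [← h1, h2]
      have h3 : ∀ A : SL 2, volume ((fun x => (x, A)) ⁻¹' {p : E × SL 2 | slVec p.2⁻¹ p.1 ∈ B}) =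
          volume B := fun A => (measurePreserving_slVec A⁻¹).measure_preimage hB.nullMeasurableSet
      simp only [h3]
      simpa using hBfin.lt_top
    have h1 := planeSystem.sqrt_integral_hit_sq_le hρ0.le hB
      (fun i f g => hgap _ (hm i) E volume planeSystem f g) hint n
    have hsq := planeSystem.integrable_hit_sq hB n (hint n)
    have hone : Measurable (B.indicator (1 : E → ℝ)) := measurable_one.indicator hB
    have hone2 : (fun x => B.indicator (1 : E → ℝ) x ^ 2) = B.indicator 1 := by
      ext1 x
      by_cases hx : x ∈ B <;> simp [hx]
    have hi1 : Integrable (B.indicator (1 : E → ℝ)) volume :=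
      (integrable_indicator_iff hB).2 (integrableOn_const hBfin)
    have h2 := sq_integral_mul_le (planeSystem.measurable_hit hB n) hone hsq
      (by rw [hone2]; exact hi1)
    rw [hone2, integral_indicator_one hB] at h2
    have h3 : ∫ x, planeSystem.hit m B n x * B.indicator (1 : E → ℝ) x ≤
        ρ ^ n * (volume : Measure E).real B := by
      calc _ ≤ √((∫ x, planeSystem.hit m B n x ^ 2) * (volume : Measure E).real B) :=
            Real.le_sqrt_of_sq_le h2
        _ = √(∫ x, planeSystem.hit m B n x ^ 2) * √((volume : Measure E).real B) :=
            Real.sqrt_mul (integral_nonneg fun x => sq_nonneg _) _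
        _ ≤ ρ ^ n * √((volume : Measure E).real B) * √((volume : Measure E).real B) := by
            gcongr
        _ = _ := by rw [mul_assoc, Real.mul_self_sqrt hBpos.le]
    have h4 : ∫ x, planeSystem.hit m B n x * B.indicator (1 : E → ℝ) x =
        ∫ A, (volume : Measure E).real {x | slVec A⁻¹ x ∈ B ∧ x ∈ B} ∂(lawT m n) := by
      have hset' : MeasurableSet {p : E × SL 2 | slVec p.2⁻¹ p.1 ∈ B ∧ p.1 ∈ B} :=
        hset.inter (measurable_fst hB)
      have h1 := Measure.prod_apply (μ := (volume : Measure E)) (ν := lawT m n) hset'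
      have h2 := Measure.prod_apply_symm (μ := (volume : Measure E)) (ν := lawT m n) hset'
      have hfin : ∀ A : SL 2, volume {x : E | slVec A⁻¹ x ∈ B ∧ x ∈ B} < ∞ := fun A =>
        (measure_mono fun x hx => hx.2).trans_lt hBfin.lt_top
      have e1 := integral_toReal (μ := lawT m n)
        (measurable_measure_prodMk_right (μ := (volume : Measure E)) hset').aemeasurable
        (Eventually.of_forall hfin)
      have e2 := integral_toReal (μ := (volume : Measure E))
        (measurable_measure_prodMk_left (ν := lawT m n) hset').aemeasurable
        (Eventually.of_forall fun x => measure_lt_top _ _)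
      rw [← h2, h1, ← e2] at e1
      refine Eq.trans ?_ e1.symm
      congr 1
      ext1 x
      by_cases hx : x ∈ B
      · simp only [hx, Set.indicator_of_mem, Pi.one_apply, mul_one]
        simp only [Set.preimage, Set.mem_ofPred_eq, hx, and_true]
        rfl
      · simp [hx, Set.preimage]
    have h5 : ∀ A : SL 2, (slNorm A ^ 2)⁻¹ * (volume : Measure E).real B ≤
        (volume : Measure E).real {x | slVec A⁻¹ x ∈ B ∧ x ∈ B} := by
      intro A
      have e : (volume : Measure E).real (Metric.closedBall 0 (slNorm A)⁻¹) =
          (slNorm A ^ 2)⁻¹ * (volume : Measure E).real B := by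
        have := Measure.addHaar_real_closedBall (volume : Measure E) 0
          (inv_nonneg.2 (slNorm_nonneg A))
        rw [this, finrank_euclideanSpace_fin, inv_pow, hBdef,
          Measure.addHaar_real_closedBall (volume : Measure E) 0 zero_le_one]
        simp
      rw [← e]
      refine measureReal_mono (fun x hx => ?_) ((measure_mono fun x hx => hx.2).trans_lt
        hBfin.lt_top).ne
      rw [mem_closedBall_zero_iff] at hx
      constructor
      · rw [hBdef, mem_closedBall_zero_iff]
        refine (norm_slVec_inv_le A x).trans ?_
        calc slNorm A * ‖x‖ ≤ slNorm A * (slNorm A)⁻¹ := by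
              gcongr; exact slNorm_nonneg A
          _ = 1 := mul_inv_cancel₀ (slNorm_pos A).ne'
      · rw [hBdef, mem_closedBall_zero_iff]
        exact hx.trans (inv_le_one_of_one_le₀ (one_le_slNorm A))
    have h6 : ∫ A, (slNorm A ^ 2)⁻¹ * (volume : Measure E).real B ∂(lawT m n) ≤
        ∫ A, (volume : Measure E).real {x | slVec A⁻¹ x ∈ B ∧ x ∈ B} ∂(lawT m n) := by
      have hset' : MeasurableSet {p : E × SL 2 | slVec p.2⁻¹ p.1 ∈ B ∧ p.1 ∈ B} :=
        hset.inter (measurable_fst hB)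
      refine integral_mono_of_nonneg (Eventually.of_forall fun A => by positivity) ?_
        (Eventually.of_forall h5)
      refine Integrable.of_bound (measurable_measure_prodMk_right
        (μ := (volume : Measure E)) hset').ennreal_toReal.aestronglyMeasurable
        ((volume : Measure E).real B) (Eventually.of_forall fun A => ?_)
      rw [Real.norm_of_nonneg measureReal_nonneg]
      exact measureReal_mono (fun x hx => hx.2) hBfin
    rw [integral_mul_const, ← h4] at h6
    exact le_of_mul_le_mul_right (h6.trans h3) hBpos

end Decay

/-- Jensen's inequality for the logarithm. -/
theorem integral_log_le {Ω : Type*} [MeasurableSpace Ω] {P : Measure Ω} [IsProbabilityMeasure P]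
    {Y : Ω → ℝ} (hpos : ∀ x, 0 < Y x) (hY : Integrable Y P)
    (hlog : Integrable (fun x => Real.log (Y x)) P) {c : ℝ} (h : ∫ x, Y x ∂P ≤ Real.exp c) :
    ∫ x, Real.log (Y x) ∂P ≤ c := by
  have h1 : ∀ x, Real.log (Y x) ≤ (Real.exp c)⁻¹ * Y x + (c - 1) := by
    intro x
    have h2 := Real.log_le_sub_one_of_pos (mul_pos (inv_pos.2 (Real.exp_pos c)) (hpos x))
    rw [Real.log_mul (inv_pos.2 (Real.exp_pos c)).ne' (hpos x).ne', Real.log_inv,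
      Real.log_exp] at h2
    linarith
  have hi : Integrable (fun x => (Real.exp c)⁻¹ * Y x) P := hY.const_mul _
  calc ∫ x, Real.log (Y x) ∂P ≤ ∫ x, ((Real.exp c)⁻¹ * Y x + (c - 1)) ∂P :=
        integral_mono hlog (hi.add (integrable_const _)) h1
    _ = (Real.exp c)⁻¹ * ∫ x, Y x ∂P + (c - 1) := by
        rw [integral_add hi (integrable_const _), integral_const_mul]; simp
    _ ≤ (Real.exp c)⁻¹ * Real.exp c + (c - 1) := by gcongr
    _ = c := by rw [inv_mul_cancel₀ (Real.exp_pos c).ne']; ring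

/-- The sequence of laws seen after time `k`. -/
def shiftSeq (k : ℕ) (m : ℕ → ProbabilityMeasure (SL 2)) : ℕ → ProbabilityMeasure (SL 2) :=
  fun i => m (k + i)

theorem lawT_add (m : ℕ → ProbabilityMeasure (SL 2)) (k n : ℕ) :
    lawT m (k + n) = Measure.mconv (lawT (shiftSeq k m) n) (lawT m k) := by
  induction n with
  | zero => rw [add_zero, lawT.eq_1 (shiftSeq k m), Measure.dirac_one_mconv]
  | succ n ih =>
    rw [← add_assoc, lawT, ih, lawT, Measure.mconv_assoc]
    rfl

theorem log_slNorm_nonneg (A : SL 2) : 0 ≤ Real.log (slNorm A) :=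
  Real.log_nonneg (one_le_slNorm A)

theorem log_slNorm_mul_le (A B : SL 2) :
    Real.log (slNorm (A * B)) ≤ Real.log (slNorm A) + Real.log (slNorm B) := by
  rw [← Real.log_mul (slNorm_pos A).ne' (slNorm_pos B).ne']
  exact Real.log_le_log (slNorm_pos _) (slNorm_mul_le A B)

theorem norm_slVec_circ_pos (A : SL 2) (u : Circ) :
    0 < ‖slVec A (u : EuclideanSpace ℝ (Fin 2))‖ :=
  norm_pos_iff.2 (slVec_ne_zero A u.ne_zero)

theorem neg_log_slNorm_le (A : SL 2) (u : Circ) :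
    -Real.log (slNorm A) ≤ Real.log ‖slVec A (u : EuclideanSpace ℝ (Fin 2))‖ := by
  have h := norm_le_slNorm_mul A (u : EuclideanSpace ℝ (Fin 2))
  rw [norm_eq_of_mem_sphere u] at h
  have h2 := Real.log_le_log one_pos h
  rw [Real.log_one, Real.log_mul (slNorm_pos A).ne' (norm_slVec_circ_pos A u).ne'] at h2
  linarith

theorem log_norm_slVec_le (A : SL 2) (u : Circ) :
    Real.log ‖slVec A (u : EuclideanSpace ℝ (Fin 2))‖ ≤ Real.log (slNorm A) := by
  have h := norm_slVec_le A (u : EuclideanSpace ℝ (Fin 2))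
  rw [norm_eq_of_mem_sphere u, mul_one] at h
  exact Real.log_le_log (norm_slVec_circ_pos A u) h

theorem abs_log_norm_slVec_le (A : SL 2) (u : Circ) :
    |Real.log ‖slVec A (u : EuclideanSpace ℝ (Fin 2))‖| ≤ Real.log (slNorm A) :=
  abs_le.2 ⟨neg_log_slNorm_le A u, log_norm_slVec_le A u⟩

theorem measurable_log_slNorm : Measurable (fun A : SL 2 => Real.log (slNorm A)) :=
  Real.measurable_log.comp measurable_slNorm

theorem measurable_norm_slVec (v : EuclideanSpace ℝ (Fin 2)) :
    Measurable (fun A : SL 2 => ‖slVec A v‖) :=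
  (continuous_slVec.comp (Continuous.prodMk_left v)).norm.measurable

theorem log_norm_slVec_mul (A B : SL 2) (u : Circ) :
    Real.log ‖slVec (A * B) (u : EuclideanSpace ℝ (Fin 2))‖ =
      Real.log ‖slVec A (circAct B u : EuclideanSpace ℝ (Fin 2))‖ +
        Real.log ‖slVec B (u : EuclideanSpace ℝ (Fin 2))‖ := by
  have hB := norm_slVec_circ_pos B u
  have e : slVec B (u : EuclideanSpace ℝ (Fin 2)) =
      ‖slVec B (u : EuclideanSpace ℝ (Fin 2))‖ • (circAct B u : EuclideanSpace ℝ (Fin 2)) := by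
    rw [circAct, coe_dir (slVec_ne_zero B u.ne_zero), smul_smul, mul_inv_cancel₀ hB.ne', one_smul]
  conv_lhs => rw [slVec_mul, e, slVec_smul, norm_smul, norm_norm]
  rw [Real.log_mul hB.ne' (norm_slVec_circ_pos A _).ne', add_comm]

section Moments

variable {γ C : ℝ} {m : ℕ → ProbabilityMeasure (SL 2)}

theorem lintegral_slNorm_rpow_le (hγ : 0 < γ) (hm : ∀ i, FiniteMomentCondition γ C (m i))
    (n : ℕ) : ∫⁻ A, ENNReal.ofReal (slNorm A ^ γ) ∂(lawT m n) ≤ ENNReal.ofReal (C ^ n) := by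
  have hC : 0 ≤ C := by linarith [(hm 0).one_lt hγ]
  have hmeas : Measurable (fun A : SL 2 => ENNReal.ofReal (slNorm A ^ γ)) :=
    (measurable_slNorm.pow_const γ).ennreal_ofReal
  induction n with
  | zero =>
    have h1 : slNorm (1 : SL 2) = 1 := by simp [slNorm, opNorm]
    rw [lawT, lintegral_dirac' _ hmeas, h1]
    simp
  | succ n ih =>
    rw [lawT, Measure.lintegral_mconv hmeas]
    calc ∫⁻ a, ∫⁻ b, ENNReal.ofReal (slNorm (a * b) ^ γ) ∂(lawT m n) ∂(m n : Measure (SL 2))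
        ≤ ∫⁻ a, ∫⁻ b, ENNReal.ofReal (slNorm a ^ γ) * ENNReal.ofReal (slNorm b ^ γ)
            ∂(lawT m n) ∂(m n : Measure (SL 2)) := by
          refine lintegral_mono fun a => lintegral_mono fun b => ?_
          rw [← ENNReal.ofReal_mul (Real.rpow_nonneg (slNorm_nonneg a) γ),
            ← Real.mul_rpow (slNorm_nonneg a) (slNorm_nonneg b)]
          exact ENNReal.ofReal_le_ofReal
            (Real.rpow_le_rpow (slNorm_nonneg _) (slNorm_mul_le a b) hγ.le)
      _ = (∫⁻ a, ENNReal.ofReal (slNorm a ^ γ) ∂(m n : Measure (SL 2))) *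
            ∫⁻ b, ENNReal.ofReal (slNorm b ^ γ) ∂(lawT m n) := by
          simp only [lintegral_const_mul _ hmeas]
          rw [lintegral_mul_const _ hmeas]
      _ ≤ ENNReal.ofReal C * ENNReal.ofReal (C ^ n) := mul_le_mul' (hm n).le ih
      _ = _ := by rw [← ENNReal.ofReal_mul hC, pow_succ']

theorem integrable_slNorm_rpow (hγ : 0 < γ) (hm : ∀ i, FiniteMomentCondition γ C (m i)) (n : ℕ) :
    Integrable (fun A => slNorm A ^ γ) (lawT m n) := by
  refine ⟨(measurable_slNorm.pow_const γ).aestronglyMeasurable, ?_⟩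
  rw [hasFiniteIntegral_iff_ofReal
    (Eventually.of_forall fun A => Real.rpow_nonneg (slNorm_nonneg A) γ)]
  exact (lintegral_slNorm_rpow_le hγ hm n).trans_lt ENNReal.ofReal_lt_top

theorem integral_slNorm_rpow_le (hγ : 0 < γ) (hm : ∀ i, FiniteMomentCondition γ C (m i))
    (n : ℕ) : ∫ A, slNorm A ^ γ ∂(lawT m n) ≤ C ^ n := by
  have hC : 0 ≤ C := by linarith [(hm 0).one_lt hγ]
  rw [integral_eq_lintegral_of_nonneg_ae
    (Eventually.of_forall fun A => Real.rpow_nonneg (slNorm_nonneg A) γ)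
    (measurable_slNorm.pow_const γ).aestronglyMeasurable]
  exact ENNReal.toReal_le_of_le_ofReal (pow_nonneg hC n) (lintegral_slNorm_rpow_le hγ hm n)

theorem integrable_log_slNorm (hγ : 0 < γ) (hm : ∀ i, FiniteMomentCondition γ C (m i)) (n : ℕ) :
    Integrable (fun A => Real.log (slNorm A)) (lawT m n) := by
  refine ((integrable_slNorm_rpow hγ hm n).div_const γ).mono'
    measurable_log_slNorm.aestronglyMeasurable (Eventually.of_forall fun A => ?_)
  rw [Real.norm_of_nonneg (log_slNorm_nonneg A)]
  exact Real.log_le_rpow_div (slNorm_nonneg A) hγ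

theorem integrable_log_norm_slVec (hγ : 0 < γ) (hm : ∀ i, FiniteMomentCondition γ C (m i))
    (n : ℕ) (u : Circ) :
    Integrable (fun A => Real.log ‖slVec A (u : EuclideanSpace ℝ (Fin 2))‖) (lawT m n) :=
  (integrable_log_slNorm hγ hm n).mono'
    (Real.measurable_log.comp (measurable_norm_slVec _)).aestronglyMeasurable
    (Eventually.of_forall fun A => abs_log_norm_slVec_le A u)

theorem integral_log_slNorm_le (hγ : 0 < γ) (hm : ∀ i, FiniteMomentCondition γ C (m i))
    (n : ℕ) : ∫ A, Real.log (slNorm A) ∂(lawT m n) ≤ n * (Real.log C / γ) := by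
  have hC : 0 < C := by linarith [(hm 0).one_lt hγ]
  have e : ∀ A : SL 2, Real.log (slNorm A ^ γ) = γ * Real.log (slNorm A) :=
    fun A => Real.log_rpow (slNorm_pos A) γ
  have h := integral_log_le (P := lawT m n) (Y := fun A => slNorm A ^ γ) (c := n * Real.log C)
    (fun A => Real.rpow_pos_of_pos (slNorm_pos A) γ) (integrable_slNorm_rpow hγ hm n)
    (by simp only [e]; exact (integrable_log_slNorm hγ hm n).const_mul γ)
    (by rw [mul_comm, Real.exp_mul, Real.exp_log hC, Real.rpow_natCast]
        exact integral_slNorm_rpow_le hγ hm n)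
  simp only [e] at h
  rw [integral_const_mul] at h
  rw [mul_div_assoc', le_div_iff₀ hγ]
  linarith

theorem le_integral_log_slNorm (hγ : 0 < γ) (hm : ∀ i, FiniteMomentCondition γ C (m i))
    (n : ℕ) {ρ : ℝ} (hρ : 0 < ρ) (h : ∫ A, (slNorm A ^ 2)⁻¹ ∂(lawT m n) ≤ ρ ^ n) :
    n * (-Real.log ρ / 2) ≤ ∫ A, Real.log (slNorm A) ∂(lawT m n) := by
  have e : ∀ A : SL 2, Real.log ((slNorm A ^ 2)⁻¹) = -2 * Real.log (slNorm A) := fun A => by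
    rw [Real.log_inv, Real.log_pow]; push_cast; ring
  have h := integral_log_le (P := lawT m n) (Y := fun A => (slNorm A ^ 2)⁻¹) (c := n * Real.log ρ)
    (fun A => inv_pos.2 (pow_pos (slNorm_pos A) 2))
    (Integrable.of_bound (measurable_slNorm.pow_const 2).inv.aestronglyMeasurable 1
      (Eventually.of_forall fun A => by
        rw [Real.norm_of_nonneg (by positivity)]
        exact inv_le_one_of_one_le₀ (one_le_pow₀ (one_le_slNorm A))))
    (by simp only [e]; exact (integrable_log_slNorm hγ hm n).const_mul (-2))
    (by rw [mul_comm, Real.exp_mul, Real.exp_log hρ, Real.rpow_natCast]; exact h)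
  simp only [e] at h
  rw [integral_const_mul] at h
  linarith

end Moments

theorem continuous_integral_lawT {K : Set (ProbabilityMeasure (SL 2))} {γ C : ℝ} (hγ : 0 < γ)
    (hmom : ∀ μ ∈ K, FiniteMomentCondition γ C μ) {M : ℝ} (n : ℕ) :
    ∀ {Θ : Type} [TopologicalSpace Θ] {h : Θ × SL 2 → ℝ}, Continuous h → (∀ p, |h p| ≤ M) →
      Continuous (fun p : Θ × (ℕ → K) => ∫ a, h (p.1, a) ∂(lawT (fun i => p.2 i) n)) := by
  induction n with
  | zero =>
    intro Θ _ h hc hM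
    have e : ∀ p : Θ × (ℕ → K), ∫ a, h (p.1, a) ∂(lawT (fun i => p.2 i) 0) = h (p.1, 1) := by
      intro p
      have h1 : Continuous (fun a => h (p.1, a)) := by fun_prop
      rw [lawT, integral_dirac' (fun a => h (p.1, a)) _ h1.measurable.stronglyMeasurable]
    simp only [e]
    fun_prop
  | succ n ih =>
    intro Θ _ h hc hM
    have hin := ih (Θ := Θ × SL 2) (h := fun p => h (p.1.1, p.1.2 * p.2)) (by fun_prop)
      (fun p => hM _)
    have hout := continuous_integral_of_tight (Θ := Θ × (ℕ → K)) (κ := K) (P := Subtype.val)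
      continuous_subtype_val (tight_of_finiteMoment hγ hmom)
      (h := fun q => ∫ b, h (q.1.1, q.2 * b) ∂(lawT (fun i => q.1.2 i) n))
      (hin.comp (f := fun q : (Θ × (ℕ → K)) × SL 2 => ((q.1.1, q.2), q.1.2)) (by fun_prop))
      (M := M) (fun q => by
        refine abs_integral_le_integral_abs.trans ?_
        have h1 : Integrable (fun b => h (q.1.1, q.2 * b)) (lawT (fun i => q.1.2 i) n) :=
          Integrable.of_bound (Continuous.aestronglyMeasurable (by fun_prop)) M
            (Eventually.of_forall fun a => hM _)
        refine (integral_mono h1.abs (integrable_const M) fun b => hM _).trans ?_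
        simp)
    have h2 := hout.comp (f := fun p : Θ × (ℕ → K) => (p, p.2 n)) (by fun_prop)
    refine h2.congr fun p => ?_
    rw [lawT, integral_mconv]
    · rfl
    · refine Integrable.of_bound (Continuous.aestronglyMeasurable ?_) M
        (Eventually.of_forall fun a => hM _)
      fun_prop

/-- The unit vector obtained from `z` by a quarter turn. -/
def quarterTurn (z : Circ) : EuclideanSpace ℝ (Fin 2) :=
  !₂[-(z : EuclideanSpace ℝ (Fin 2)) 1, (z : EuclideanSpace ℝ (Fin 2)) 0]

theorem norm_quarterTurn (z : Circ) : ‖quarterTurn z‖ = 1 := by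
  have h := norm_sq_two (z : EuclideanSpace ℝ (Fin 2))
  have h2 := norm_sq_two (quarterTurn z)
  rw [norm_eq_of_mem_sphere z] at h
  simp only [quarterTurn] at h2 ⊢
  simp at h2
  rw [← sq_eq_sq₀ (norm_nonneg _) zero_le_one, h2]
  linarith

theorem inner_two (v w : EuclideanSpace ℝ (Fin 2)) : inner ℝ v w = v 0 * w 0 + v 1 * w 1 := by
  rw [EuclideanSpace.inner_eq_star_dotProduct]
  simp [dotProduct, Fin.sum_univ_two, mul_comm]

theorem eq_or_eq_of_inner_eq_zero (z : Circ) :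
    ∃ x y : Circ, ∀ w : Circ, inner ℝ (z : EuclideanSpace ℝ (Fin 2)) w = 0 → w = x ∨ w = y := by
  refine ⟨⟨quarterTurn z, by simp [norm_quarterTurn]⟩,
    ⟨-quarterTurn z, by simp [norm_quarterTurn]⟩, fun w hw => ?_⟩
  have hz := norm_sq_two (z : EuclideanSpace ℝ (Fin 2))
  have hw2 := norm_sq_two (w : EuclideanSpace ℝ (Fin 2))
  rw [norm_eq_of_mem_sphere] at hz hw2
  rw [inner_two] at hw
  set a := (z : EuclideanSpace ℝ (Fin 2)) 0
  set b := (z : EuclideanSpace ℝ (Fin 2)) 1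
  set c := (w : EuclideanSpace ℝ (Fin 2)) 0 with hc
  set d := (w : EuclideanSpace ℝ (Fin 2)) 1 with hd
  have h0 : c = -(a * d - b * c) * b := by linear_combination c * hz + a * hw
  have h1 : d = (a * d - b * c) * a := by linear_combination d * hz + b * hw
  have hs : (a * d - b * c) ^ 2 = 1 := by
    linear_combination (-1 : ℝ) * hw2 - (c ^ 2 + d ^ 2) * hz -
      (a * c + b * d) * hw
  rcases sq_eq_sq_iff_eq_or_eq_neg.1 (hs.trans (one_pow 2).symm) with h | h
  · left
    rw [h] at h0 h1
    ext i
    fin_cases i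
    · simpa [quarterTurn] using h0
    · simpa [quarterTurn] using h1
  · right
    rw [h] at h0 h1
    ext i
    fin_cases i
    · simpa [quarterTurn] using h0
    · simpa [quarterTurn] using h1

/-- A tent function concentrating at `0`. -/
def tent (k : ℕ) (t : ℝ) : ℝ := max 0 (1 - (k + 1) * |t|)

theorem continuous_tent (k : ℕ) : Continuous (tent k) := by
  unfold tent; fun_prop

theorem tent_nonneg (k : ℕ) (t : ℝ) : 0 ≤ tent k t := le_max_left _ _

theorem tent_le_one (k : ℕ) (t : ℝ) : tent k t ≤ 1 := by
  refine max_le zero_le_one ?_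
  have : 0 ≤ ((k : ℝ) + 1) * |t| := by positivity
  linarith

theorem abs_tent_le_one (k : ℕ) (t : ℝ) : |tent k t| ≤ 1 := by
  rw [abs_of_nonneg (tent_nonneg k t)]; exact tent_le_one k t

theorem tent_antitone {k l : ℕ} (h : k ≤ l) (t : ℝ) : tent l t ≤ tent k t := by
  unfold tent; gcongr

theorem tendsto_tent (t : ℝ) :
    Tendsto (fun k => tent k t) atTop (nhds (if t = 0 then 1 else 0)) := by
  split_ifs with h
  · simp [tent, h]
  · have ht : 0 < |t| := abs_pos.2 h
    obtain ⟨N, hN⟩ := exists_nat_gt (1 / |t|)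
    rw [div_lt_iff₀ ht] at hN
    apply tendsto_const_nhds.congr'
    filter_upwards [eventually_ge_atTop N] with k hk
    have : (N : ℝ) ≤ k := by exact_mod_cast hk
    rw [tent, max_eq_left]
    nlinarith

theorem continuous_inner_circAct : Continuous (fun q : (Circ × Circ) × SL 2 =>
    inner ℝ (q.1.1 : EuclideanSpace ℝ (Fin 2)) (circAct q.2 q.1.2 : EuclideanSpace ℝ (Fin 2))) := by
  have h : Continuous (fun q : (Circ × Circ) × SL 2 => circAct q.2 q.1.2) :=
    continuous_circAct.comp (f := fun q : (Circ × Circ) × SL 2 => (q.2, q.1.2)) (by fun_prop)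
  exact (continuous_subtype_val.comp (by fun_prop)).inner (continuous_subtype_val.comp h)

set_option maxHeartbeats 1000000 in
/-- Uniform non-concentration near hyperplanes, from the absence of large atoms. -/
theorem exists_nonconcentration {K : Set (ProbabilityMeasure (SL 2))} (hK : IsCompact K)
    {γ C : ℝ} (hγ : 0 < γ) (hmom : ∀ μ ∈ K, FiniteMomentCondition γ C μ) {n : ℕ} {r η : ℝ}
    (hatom : ∀ m : ℕ → ProbabilityMeasure (SL 2), (∀ i, m i ∈ K) → ∀ x y : Circ,
      (lawT m n).real {A | circAct A y = x} ≤ r) (hr : 4 * r < η) :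
    ∃ δ : ℝ, 0 < δ ∧ δ < 1 ∧ ∀ m : ℕ → ProbabilityMeasure (SL 2), (∀ i, m i ∈ K) →
      ∀ z u : Circ, (lawT m n).real {A | |inner ℝ (z : EuclideanSpace ℝ (Fin 2))
        (circAct A u : EuclideanSpace ℝ (Fin 2))| < δ} ≤ η := by
  have := isCompact_iff_compactSpace.1 hK
  let J : (Circ × Circ) × SL 2 → ℝ := fun q => inner ℝ (q.1.1 : EuclideanSpace ℝ (Fin 2))
    (circAct q.2 q.1.2 : EuclideanSpace ℝ (Fin 2))
  have hJ : Continuous J := continuous_inner_circAct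
  let Φ : ℕ → (Circ × Circ) × (ℕ → K) → ℝ := fun k p =>
    ∫ A, tent k (J (p.1, A)) ∂(lawT (fun i => p.2 i) n)
  have hΦ : ∀ k, Continuous (Φ k) := fun k =>
    continuous_integral_lawT hγ hmom n (h := fun q => tent k (J q))
      ((continuous_tent k).comp hJ) (fun p => abs_tent_le_one k _)
  have hJm : ∀ p, Measurable (fun A => J (p, A)) := fun p =>
    (hJ.comp (Continuous.prodMk_right p)).measurable
  have hint : ∀ k (p : (Circ × Circ) × (ℕ → K)),
      Integrable (fun A => tent k (J (p.1, A))) (lawT (fun i => (p.2 i).1) n) :=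
    fun k p => Integrable.of_bound
      ((continuous_tent k).measurable.comp (hJm p.1)).aestronglyMeasurable 1
      (Eventually.of_forall fun A => abs_tent_le_one k _)
  have hanti : ∀ p, Antitone (fun k => Φ k p) := fun p k l hkl =>
    integral_mono (hint l p) (hint k p) fun A => tent_antitone hkl _
  have hlim : ∀ p, ∃ k, Φ k p < η / 2 := by
    intro p
    have h1 : Tendsto (fun k => Φ k p) atTop
        (nhds (∫ A, (if J (p.1, A) = 0 then (1 : ℝ) else 0) ∂(lawT (fun i => (p.2 i).1) n))) :=
      tendsto_integral_of_dominated_convergence (fun _ => 1)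
        (fun k => (hint k p).aestronglyMeasurable) (integrable_const _)
        (fun k => Eventually.of_forall fun A => abs_tent_le_one k _)
        (Eventually.of_forall fun A => tendsto_tent _)
    have h2 : ∫ A, (if J (p.1, A) = 0 then (1 : ℝ) else 0) ∂(lawT (fun i => (p.2 i).1) n) =
        (lawT (fun i => (p.2 i).1) n).real {A | J (p.1, A) = 0} := by
      have hs : MeasurableSet {A | J (p.1, A) = 0} := hJm p.1 (measurableSet_singleton 0)
      rw [← integral_indicator_one hs]
      congr 1
    obtain ⟨x, y, hxy⟩ := eq_or_eq_of_inner_eq_zero p.1.1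
    have h3 : (lawT (fun i => (p.2 i).1) n).real {A | J (p.1, A) = 0} ≤ r + r :=
      calc _ ≤ (lawT (fun i => (p.2 i).1) n).real
              ({A | circAct A p.1.2 = x} ∪ {A | circAct A p.1.2 = y}) :=
            measureReal_mono fun A hA => hxy _ hA
        _ ≤ _ := measureReal_union_le _ _
        _ ≤ _ := add_le_add (hatom _ (fun i => (p.2 i).2) x _) (hatom _ (fun i => (p.2 i).2) y _)
    rw [h2] at h1
    exact (h1.eventually_lt_const (show _ < η / 2 by linarith)).exists
  obtain ⟨k, hk⟩ := isCompact_univ.elim_directed_cover (fun k => {p | Φ k p < η / 2})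
    (fun k => isOpen_lt (hΦ k) continuous_const)
    (fun p _ => Set.mem_iUnion.2 (hlim p))
    (directed_of_isDirected_le fun k l hkl p hp => (hanti p hkl).trans_lt hp)
  refine ⟨1 / (2 * (k + 1)), by positivity, ?_, fun m hm z u => ?_⟩
  · rw [div_lt_one (by positivity)]
    have : (0 : ℝ) ≤ k := k.cast_nonneg
    linarith
  · let p : (Circ × Circ) × (ℕ → K) := ((z, u), fun i => ⟨m i, hm i⟩)
    have h1 : Φ k p < η / 2 := hk (Set.mem_univ p)
    have hms : MeasurableSet {A | |J ((z, u), A)| < 1 / (2 * ((k : ℝ) + 1))} :=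
      measurableSet_lt (continuous_abs.measurable.comp (hJm _)) measurable_const
    have h2 : (lawT m n).real {A | |J ((z, u), A)| < 1 / (2 * ((k : ℝ) + 1))} ≤ 2 * Φ k p := by
      rw [← integral_indicator_one hms, ← integral_const_mul]
      refine integral_mono ((integrable_const 1).indicator hms) ((hint k p).const_mul 2) fun A => ?_
      by_cases hA : A ∈ {A | |J ((z, u), A)| < 1 / (2 * ((k : ℝ) + 1))}
      · rw [Set.indicator_of_mem hA]
        have hA' : |J ((z, u), A)| < 1 / (2 * ((k : ℝ) + 1)) := hA
        rw [lt_div_iff₀ (by positivity)] at hA'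
        have : 1 - ((k : ℝ) + 1) * |J (p.1, A)| ≤ tent k (J (p.1, A)) := le_max_right _ _
        simp only [Pi.one_apply, p] at this ⊢
        linarith
      · rw [Set.indicator_of_notMem hA]
        have := tent_nonneg k (J (p.1, A))
        simp only
        linarith
    exact h2.trans (by linarith)

theorem le_log_norm_slVec_mul {A : SL 2} {z : EuclideanSpace ℝ (Fin 2)}
    (hz : ∀ u, slNorm A / 2 * |inner ℝ z u| ≤ ‖slVec A u‖) {δ : ℝ} (hδ : 0 < δ) (hδ1 : δ < 1)
    (B : SL 2) (u : Circ) :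
    Real.log (slNorm A) - Real.log (2 / δ) - 2 * Real.log (slNorm A) *
      Set.indicator {B : SL 2 | |inner ℝ z (circAct B u : EuclideanSpace ℝ (Fin 2))| < δ} 1 B -
      Real.log (slNorm B) ≤
    Real.log ‖slVec (A * B) (u : EuclideanSpace ℝ (Fin 2))‖ := by
  rw [log_norm_slVec_mul]
  have hB := neg_log_slNorm_le B u
  have h2 : 0 ≤ Real.log (2 / δ) := Real.log_nonneg ((one_le_div hδ).2 (by linarith))
  by_cases h : B ∈ {B : SL 2 | |inner ℝ z (circAct B u : EuclideanSpace ℝ (Fin 2))| < δ}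
  · rw [Set.indicator_of_mem h, Pi.one_apply]
    have := neg_log_slNorm_le A (circAct B u)
    linarith
  · rw [Set.indicator_of_notMem h]
    have h3 : δ ≤ |inner ℝ z (circAct B u : EuclideanSpace ℝ (Fin 2))| := not_lt.1 h
    have h4 : slNorm A / (2 / δ) ≤ ‖slVec A (circAct B u : EuclideanSpace ℝ (Fin 2))‖ :=
      calc slNorm A / (2 / δ) = slNorm A / 2 * δ := by field_simp
        _ ≤ _ := mul_le_mul_of_nonneg_left h3 (by linarith [slNorm_pos A])
        _ ≤ _ := hz _
    have h5 := Real.log_le_log (div_pos (slNorm_pos A) (by positivity)) h4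
    rw [Real.log_div (slNorm_pos A).ne' (by positivity)] at h5
    linarith

section VectorBound

variable {γ C : ℝ} {m : ℕ → ProbabilityMeasure (SL 2)}

theorem integral_log_norm_slVec_ge (hγ : 0 < γ) (hm : ∀ i, FiniteMomentCondition γ C (m i))
    {k r : ℕ} {δ η : ℝ} (hδ : 0 < δ) (hδ1 : δ < 1) (hη : 0 ≤ η)
    (h : ∀ z u : Circ, (lawT m k).real {A | |inner ℝ (z : EuclideanSpace ℝ (Fin 2))
        (circAct A u : EuclideanSpace ℝ (Fin 2))| < δ} ≤ η) (u : Circ) :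
    ∫ A, Real.log (slNorm A) ∂(lawT m (k + r)) - Real.log (2 / δ) - 2 * k * (Real.log C / γ) -
        2 * η * (r * (Real.log C / γ)) ≤
      ∫ A, Real.log ‖slVec A (u : EuclideanSpace ℝ (Fin 2))‖ ∂(lawT m (k + r)) := by
  set P := lawT (shiftSeq k m) r with hP
  set Q := lawT m k with hQ
  have hm' : ∀ i, FiniteMomentCondition γ C (shiftSeq k m i) := fun i => hm _
  have iP : Integrable (fun A => Real.log (slNorm A)) P := integrable_log_slNorm hγ hm' r
  have iQ : Integrable (fun A => Real.log (slNorm A)) Q := integrable_log_slNorm hγ hm k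
  have bP : ∫ A, Real.log (slNorm A) ∂P ≤ r * (Real.log C / γ) := integral_log_slNorm_le hγ hm' r
  have bQ : ∫ A, Real.log (slNorm A) ∂Q ≤ k * (Real.log C / γ) := integral_log_slNorm_le hγ hm k
  have i1 := integrable_log_slNorm hγ hm (k + r)
  have i2 := integrable_log_norm_slVec hγ hm (k + r) u
  rw [lawT_add, ← hP, ← hQ] at i1 i2 ⊢
  rw [integral_mconv i1, integral_mconv i2]
  have j1 : Integrable (fun A => ∫ B, Real.log (slNorm (A * B)) ∂Q) P := by
    rw [Measure.mconv, integrable_map_measure i1.1 (by fun_prop)] at i1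
    exact i1.integral_prod_left
  have j2 : Integrable (fun A => ∫ B, Real.log ‖slVec (A * B)
      (u : EuclideanSpace ℝ (Fin 2))‖ ∂Q) P := by
    rw [Measure.mconv, integrable_map_measure i2.1 (by fun_prop)] at i2
    exact i2.integral_prod_left
  have hle : ∀ A B : SL 2, |Real.log (slNorm (A * B))| ≤
      Real.log (slNorm A) + Real.log (slNorm B) := fun A B => by
    rw [abs_of_nonneg (log_slNorm_nonneg _)]
    exact log_slNorm_mul_le A B
  have iin : ∀ A : SL 2, Integrable (fun B => Real.log (slNorm (A * B))) Q := fun A =>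
    ((integrable_const (Real.log (slNorm A))).add iQ).mono'
      (measurable_log_slNorm.comp (measurable_const_mul A)).aestronglyMeasurable
      (Eventually.of_forall fun B => hle A B)
  have iinv : ∀ A : SL 2, Integrable (fun B => Real.log ‖slVec (A * B)
      (u : EuclideanSpace ℝ (Fin 2))‖) Q := fun A =>
    ((integrable_const (Real.log (slNorm A))).add iQ).mono'
      ((Real.measurable_log.comp (measurable_norm_slVec _)).comp
        (measurable_const_mul A)).aestronglyMeasurable
      (Eventually.of_forall fun B => (abs_log_norm_slVec_le _ u).trans
        ((le_abs_self _).trans (hle A B)))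
  have hup : ∫ A, ∫ B, Real.log (slNorm (A * B)) ∂Q ∂P ≤
      ∫ A, Real.log (slNorm A) ∂P + ∫ B, Real.log (slNorm B) ∂Q := by
    calc _ ≤ ∫ A, (Real.log (slNorm A) + ∫ B, Real.log (slNorm B) ∂Q) ∂P := by
          refine integral_mono j1 (iP.add (integrable_const _)) fun A => ?_
          have := integral_mono (iin A) ((integrable_const (Real.log (slNorm A))).add iQ)
            fun B => log_slNorm_mul_le A B
          simp only [Pi.add_apply] at this
          rw [integral_add (integrable_const _) iQ] at this
          simpa using this
      _ = _ := by rw [integral_add iP (integrable_const _)]; simp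
  have hlow : (1 - 2 * η) * ∫ A, Real.log (slNorm A) ∂P -
      (Real.log (2 / δ) + ∫ B, Real.log (slNorm B) ∂Q) ≤
      ∫ A, ∫ B, Real.log ‖slVec (A * B) (u : EuclideanSpace ℝ (Fin 2))‖ ∂Q ∂P := by
    calc _ = ∫ A, ((1 - 2 * η) * Real.log (slNorm A) -
          (Real.log (2 / δ) + ∫ B, Real.log (slNorm B) ∂Q)) ∂P := by
          rw [integral_sub (iP.const_mul _) (integrable_const _), integral_const_mul]; simp
      _ ≤ _ := by
          refine integral_mono ((iP.const_mul _).sub (integrable_const _)) j2 fun A => ?_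
          obtain ⟨z, hz1, hz⟩ := exists_unit_expanding A
          set s := {B : SL 2 | |inner ℝ z (circAct B u : EuclideanSpace ℝ (Fin 2))| < δ} with hs
          have hsm : MeasurableSet s := by
            have := continuous_inner_circAct.comp
              (f := fun B : SL 2 => (((⟨z, by simpa using hz1⟩ : Circ), u), B)) (by fun_prop)
            exact measurableSet_lt (continuous_abs.comp this).measurable measurable_const
          have hsη : Q.real s ≤ η := h ⟨z, by simpa using hz1⟩ u
          have i3 : Integrable (s.indicator (1 : SL 2 → ℝ)) Q :=
            (integrable_const (1 : ℝ)).indicator hsm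
          have i4 : Integrable (fun B => Real.log (slNorm A) - Real.log (2 / δ) -
              2 * Real.log (slNorm A) * s.indicator 1 B) Q :=
            (integrable_const _).sub (i3.const_mul _)
          have h6 := integral_mono (i4.sub iQ) (iinv A)
            fun B => le_log_norm_slVec_mul hz hδ hδ1 B u
          simp only [Pi.sub_apply] at h6
          rw [integral_sub i4 iQ, integral_sub (integrable_const _) (i3.const_mul _),
            integral_const_mul, integral_indicator_one hsm] at h6
          simp only [integral_const, probReal_univ, smul_eq_mul, one_mul] at h6
          refine le_trans ?_ h6
          nlinarith [log_slNorm_nonneg A]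
  have : η * ∫ A, Real.log (slNorm A) ∂P ≤ η * (r * (Real.log C / γ)) :=
    mul_le_mul_of_nonneg_left bP hη
  linarith

end VectorBound

theorem exists_vector_bound {K : Set (ProbabilityMeasure (SL 2))} (hK : IsCompact K)
    {γ C ρ : ℝ} (hγ : 0 < γ) (hC : 1 < C) (hmom : ∀ μ ∈ K, FiniteMomentCondition γ C μ)
    (hρ1 : ρ < 1)
    (hatom : ∀ m : ℕ → ProbabilityMeasure (SL 2), (∀ i, m i ∈ K) → ∀ n, ∀ x y : Circ,
      (lawT m n).real {A | circAct A y = x} ≤ ρ ^ n) {ε : ℝ} (hε : 0 < ε) :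
    ∃ N : ℕ, 0 < N ∧ ∀ m : ℕ → ProbabilityMeasure (SL 2), (∀ i, m i ∈ K) → ∀ u : Circ,
      ∫ A, Real.log (slNorm A) ∂(lawT m N) - ε * N ≤
        ∫ A, Real.log ‖slVec A (u : EuclideanSpace ℝ (Fin 2))‖ ∂(lawT m N) := by
  set M := Real.log C / γ with hM
  have hM0 : 0 < M := div_pos (Real.log_pos hC) hγ
  set η := ε / (4 * M) with hη
  have hη0 : 0 < η := by positivity
  obtain ⟨k, hk⟩ := exists_pow_lt_of_lt_one (show 0 < η / 4 by positivity) hρ1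
  obtain ⟨δ, hδ0, hδ1, hδ⟩ := exists_nonconcentration hK hγ hmom (n := k) (r := ρ ^ k) (η := η)
    (fun m hm x y => hatom m hm k x y) (by linarith)
  obtain ⟨r, hr⟩ := exists_nat_ge ((Real.log (2 / δ) + 2 * k * M) / (ε / 2))
  rw [div_le_iff₀ (by positivity)] at hr
  refine ⟨k + (r + 1), by omega, fun m hm u => ?_⟩
  have h := integral_log_norm_slVec_ge hγ (fun i => hmom _ (hm i)) (k := k) (r := r + 1) hδ0 hδ1
    hη0.le (hδ m hm) u
  have e : 2 * η * M = ε / 2 := by rw [hη]; field_simp; norm_num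
  rw [← hM] at h
  push_cast at h ⊢
  have e2 : 2 * η * (((r : ℝ) + 1) * M) = (r + 1) * (ε / 2) := by rw [← e]; ring
  have : 0 ≤ ε * k := by positivity
  linarith

theorem exp_le_one_add_add_sq_mul (x : ℝ) : Real.exp x ≤ 1 + x + x ^ 2 * Real.exp |x| := by
  have h1 : 1 ≤ Real.exp |x| := Real.one_le_exp (abs_nonneg x)
  have h2 : x ^ 2 ≤ x ^ 2 * Real.exp |x| := le_mul_of_one_le_right (sq_nonneg x) h1
  rcases le_total |x| 1 with h | h
  · have := (abs_le.1 (Real.abs_exp_sub_one_sub_id_le h)).2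
    linarith
  · rcases le_abs.1 h with h' | h'
    · rw [abs_of_nonneg (by linarith)]
      have : 1 * Real.exp x ≤ x ^ 2 * Real.exp x := by gcongr; nlinarith
      linarith
    · have : Real.exp x ≤ 1 := Real.exp_le_one_iff.2 (by linarith)
      nlinarith

theorem sq_log_mul_exp_le {γ s : ℝ} (hγ : 0 < γ) (hs : s ≤ γ / 2) {l : ℝ} (hl : 0 ≤ l) :
    l ^ 2 * Real.exp (s * l) ≤ 16 / γ ^ 2 * Real.exp (γ * l) := by
  have h1 : l ≤ 4 / γ * Real.exp (γ * l / 4) := by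
    have := Real.add_one_le_exp (γ * l / 4)
    calc l = 4 / γ * (γ * l / 4) := by field_simp
      _ ≤ _ := by gcongr; linarith
  calc l ^ 2 * Real.exp (s * l)
      ≤ (4 / γ * Real.exp (γ * l / 4)) ^ 2 * Real.exp (γ / 2 * l) := by gcongr
    _ = 16 / γ ^ 2 * Real.exp (γ * l) := by
        rw [mul_pow, ← Real.exp_nat_mul, mul_assoc, ← Real.exp_add]
        congr 2
        · ring
        · push_cast; ring

section ExpMoments

variable {γ C : ℝ} {m : ℕ → ProbabilityMeasure (SL 2)}

theorem lintegral_exp_le (hγ : 0 < γ) (hm : ∀ i, FiniteMomentCondition γ C (m i)) (n : ℕ)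
    {X : SL 2 → ℝ} (hX : Measurable X) (hXl : ∀ A, |X A| ≤ Real.log (slNorm A)) {s : ℝ}
    (hs0 : 0 ≤ s) (hs : s ≤ γ / 2) :
    ∫⁻ A, ENNReal.ofReal (Real.exp (s * X A)) ∂(lawT m n) ≤
      ENNReal.ofReal (Real.exp (s * ∫ A, X A ∂(lawT m n) + s ^ 2 * (16 / γ ^ 2 * C ^ n))) := by
  have iX : Integrable X (lawT m n) := (integrable_log_slNorm hγ hm n).mono'
    hX.aestronglyMeasurable (Eventually.of_forall hXl)
  have iγ := integrable_slNorm_rpow hγ hm n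
  have hpt : ∀ A, Real.exp (s * X A) ≤ 1 + s * X A + s ^ 2 * (16 / γ ^ 2) * slNorm A ^ γ := by
    intro A
    have h1 := exp_le_one_add_add_sq_mul (s * X A)
    have h2 := sq_log_mul_exp_le hγ hs (log_slNorm_nonneg A)
    rw [show Real.exp (γ * Real.log (slNorm A)) = slNorm A ^ γ by
      rw [mul_comm, Real.exp_mul, Real.exp_log (slNorm_pos A)]] at h2
    have h3 : X A ^ 2 ≤ Real.log (slNorm A) ^ 2 :=
      sq_le_sq.2 ((hXl A).trans (le_abs_self _))
    have h4 : |s * X A| ≤ s * Real.log (slNorm A) := by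
      rw [abs_mul, abs_of_nonneg hs0]
      exact mul_le_mul_of_nonneg_left (hXl A) hs0
    have h5 : (s * X A) ^ 2 * Real.exp |s * X A| ≤
        s ^ 2 * (Real.log (slNorm A) ^ 2 * Real.exp (s * Real.log (slNorm A))) := by
      rw [mul_pow, mul_assoc]
      gcongr
    have h6 := mul_le_mul_of_nonneg_left h2 (sq_nonneg s)
    linarith
  have i1 : Integrable (fun A => 1 + s * X A) (lawT m n) :=
    (integrable_const 1).add (iX.const_mul s)
  have i2 : Integrable (fun A => s ^ 2 * (16 / γ ^ 2) * slNorm A ^ γ) (lawT m n) :=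
    iγ.const_mul _
  have i3 := i1.add i2
  have h7 : ∫ A, (1 + s * X A + s ^ 2 * (16 / γ ^ 2) * slNorm A ^ γ) ∂(lawT m n) ≤
      Real.exp (s * ∫ A, X A ∂(lawT m n) + s ^ 2 * (16 / γ ^ 2 * C ^ n)) := by
    rw [integral_add i1 i2, integral_add (integrable_const 1) (iX.const_mul s),
      integral_const_mul, integral_const_mul]
    have h8 := mul_le_mul_of_nonneg_left (integral_slNorm_rpow_le hγ hm n)
      (show 0 ≤ s ^ 2 * (16 / γ ^ 2) by positivity)
    have h9 := Real.add_one_le_exp (s * ∫ A, X A ∂(lawT m n) + s ^ 2 * (16 / γ ^ 2 * C ^ n))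
    simp only [integral_const, probReal_univ, smul_eq_mul, one_mul]
    linarith
  calc _ ≤ ∫⁻ A, ENNReal.ofReal (1 + s * X A + s ^ 2 * (16 / γ ^ 2) * slNorm A ^ γ) ∂(lawT m n) :=
        lintegral_mono fun A => ENNReal.ofReal_le_ofReal (hpt A)
    _ = ENNReal.ofReal _ := (ofReal_integral_eq_lintegral_ofReal i3
        (Eventually.of_forall fun A => (Real.exp_pos _).le.trans (hpt A))).symm
    _ ≤ _ := ENNReal.ofReal_le_ofReal h7

end ExpMoments

/-- A uniform bound for the negative exponential moments of the growth of vectors. -/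
def VecMoment (s : ℝ) (m : ℕ → ProbabilityMeasure (SL 2)) (n : ℕ) (a : ℝ) : Prop :=
  ∀ u : Circ, ∫⁻ A, ENNReal.ofReal
    (Real.exp (s * -Real.log ‖slVec A (u : EuclideanSpace ℝ (Fin 2))‖)) ∂(lawT m n) ≤
      ENNReal.ofReal (Real.exp a)

/-- A bound for the exponential moments of the growth of the norm. -/
def NormMoment (s : ℝ) (m : ℕ → ProbabilityMeasure (SL 2)) (n : ℕ) (a : ℝ) : Prop :=
  ∫⁻ A, ENNReal.ofReal (Real.exp (s * Real.log (slNorm A))) ∂(lawT m n) ≤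
    ENNReal.ofReal (Real.exp a)

theorem VecMoment.mono {s : ℝ} {m : ℕ → ProbabilityMeasure (SL 2)} {n : ℕ} {a b : ℝ}
    (h : VecMoment s m n a) (hab : a ≤ b) : VecMoment s m n b := fun u =>
  (h u).trans (ENNReal.ofReal_le_ofReal (Real.exp_le_exp.2 hab))

theorem NormMoment.mono {s : ℝ} {m : ℕ → ProbabilityMeasure (SL 2)} {n : ℕ} {a b : ℝ}
    (h : NormMoment s m n a) (hab : a ≤ b) : NormMoment s m n b :=
  le_trans h (ENNReal.ofReal_le_ofReal (Real.exp_le_exp.2 hab))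

theorem measurable_exp_log_slVec (s : ℝ) (u : Circ) : Measurable (fun A : SL 2 => ENNReal.ofReal
    (Real.exp (s * -Real.log ‖slVec A (u : EuclideanSpace ℝ (Fin 2))‖))) := by
  have h := measurable_norm_slVec (u : EuclideanSpace ℝ (Fin 2))
  fun_prop

theorem measurable_exp_log_slNorm (s : ℝ) : Measurable (fun A : SL 2 => ENNReal.ofReal
    (Real.exp (s * Real.log (slNorm A)))) := by
  have h := measurable_slNorm
  fun_prop

theorem VecMoment.add {s : ℝ} {m : ℕ → ProbabilityMeasure (SL 2)} {k r : ℕ} {a b : ℝ}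
    (hk : VecMoment s m k b) (hr : VecMoment s (shiftSeq k m) r a) :
    VecMoment s m (k + r) (a + b) := by
  intro u
  have hm1 := measurable_exp_log_slVec s
  have hm2 : Measurable (fun p : SL 2 × SL 2 => ENNReal.ofReal
      (Real.exp (s * -Real.log ‖slVec (p.1 * p.2) (u : EuclideanSpace ℝ (Fin 2))‖))) :=
    (hm1 u).comp measurable_mul
  have e : ∀ A B : SL 2, ENNReal.ofReal
      (Real.exp (s * -Real.log ‖slVec (A * B) (u : EuclideanSpace ℝ (Fin 2))‖)) =
      ENNReal.ofReal (Real.exp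
        (s * -Real.log ‖slVec A (circAct B u : EuclideanSpace ℝ (Fin 2))‖)) *
      ENNReal.ofReal (Real.exp (s * -Real.log ‖slVec B (u : EuclideanSpace ℝ (Fin 2))‖)) := by
    intro A B
    rw [← ENNReal.ofReal_mul (Real.exp_pos _).le, ← Real.exp_add, log_norm_slVec_mul]
    congr 2
    ring
  rw [lawT_add, Measure.lintegral_mconv (hm1 u), lintegral_lintegral_swap hm2.aemeasurable]
  calc _ = ∫⁻ B, (∫⁻ A, ENNReal.ofReal (Real.exp
            (s * -Real.log ‖slVec A (circAct B u : EuclideanSpace ℝ (Fin 2))‖))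
              ∂(lawT (shiftSeq k m) r)) *
          ENNReal.ofReal (Real.exp (s * -Real.log ‖slVec B (u : EuclideanSpace ℝ (Fin 2))‖))
            ∂(lawT m k) := by
        refine lintegral_congr fun B => ?_
        simp only [e]
        rw [lintegral_mul_const _ (hm1 _)]
    _ ≤ ∫⁻ B, ENNReal.ofReal (Real.exp a) *
          ENNReal.ofReal (Real.exp (s * -Real.log ‖slVec B (u : EuclideanSpace ℝ (Fin 2))‖))
            ∂(lawT m k) := lintegral_mono fun B => mul_le_mul_left (hr _) _
    _ ≤ ENNReal.ofReal (Real.exp a) * ENNReal.ofReal (Real.exp b) := by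
        rw [lintegral_const_mul _ (hm1 u)]
        exact mul_le_mul_right (hk u) _
    _ = _ := by rw [← ENNReal.ofReal_mul (Real.exp_pos _).le, ← Real.exp_add]

theorem NormMoment.add {s : ℝ} (hs : 0 ≤ s) {m : ℕ → ProbabilityMeasure (SL 2)} {k r : ℕ}
    {a b : ℝ} (hk : NormMoment s m k b) (hr : NormMoment s (shiftSeq k m) r a) :
    NormMoment s m (k + r) (a + b) := by
  have hm1 := measurable_exp_log_slNorm s
  rw [NormMoment, lawT_add, Measure.lintegral_mconv hm1]
  calc _ ≤ ∫⁻ A, ∫⁻ B, ENNReal.ofReal (Real.exp (s * Real.log (slNorm A))) *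
          ENNReal.ofReal (Real.exp (s * Real.log (slNorm B)))
            ∂(lawT m k) ∂(lawT (shiftSeq k m) r) := by
        refine lintegral_mono fun A => lintegral_mono fun B => ?_
        rw [← ENNReal.ofReal_mul (Real.exp_pos _).le, ← Real.exp_add, ← mul_add]
        gcongr
        exact log_slNorm_mul_le A B
    _ = (∫⁻ A, ENNReal.ofReal (Real.exp (s * Real.log (slNorm A))) ∂(lawT (shiftSeq k m) r)) *
          ∫⁻ B, ENNReal.ofReal (Real.exp (s * Real.log (slNorm B))) ∂(lawT m k) := by
        simp only [lintegral_const_mul _ hm1]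
        rw [lintegral_mul_const _ hm1]
    _ ≤ ENNReal.ofReal (Real.exp a) * ENNReal.ofReal (Real.exp b) := mul_le_mul' hr hk
    _ = _ := by rw [← ENNReal.ofReal_mul (Real.exp_pos _).le, ← Real.exp_add]

theorem mul_integral_le_of_lintegral_exp {P : Measure (SL 2)} [IsProbabilityMeasure P]
    {X : SL 2 → ℝ} (hX : Integrable X P) (hXm : Measurable X) {s a : ℝ}
    (h : ∫⁻ A, ENNReal.ofReal (Real.exp (s * X A)) ∂P ≤ ENNReal.ofReal (Real.exp a)) :
    s * ∫ A, X A ∂P ≤ a := by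
  have hm : Measurable (fun A => Real.exp (s * X A)) := by fun_prop
  have hint : Integrable (fun A => Real.exp (s * X A)) P := by
    refine ⟨hm.aestronglyMeasurable, ?_⟩
    rw [hasFiniteIntegral_iff_ofReal (Eventually.of_forall fun A => (Real.exp_pos _).le)]
    exact h.trans_lt ENNReal.ofReal_lt_top
  have := integral_log_le (P := P) (Y := fun A => Real.exp (s * X A)) (c := a)
    (fun A => Real.exp_pos _) hint (by simpa only [Real.log_exp] using hX.const_mul s) (by
      rw [integral_eq_lintegral_of_nonneg_ae (Eventually.of_forall fun A => (Real.exp_pos _).le)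
        hm.aestronglyMeasurable]
      exact ENNReal.toReal_le_of_le_ofReal (Real.exp_pos _).le h)
  simpa only [Real.log_exp, integral_const_mul] using this

/-- The sum of the expected logarithmic norms of the first `q` blocks of length `N`. -/
def blockSum (N : ℕ) (m : ℕ → ProbabilityMeasure (SL 2)) (q : ℕ) : ℝ :=
  ∑ i ∈ Finset.range q, ∫ A, Real.log (slNorm A) ∂(lawT (shiftSeq (i * N) m) N)

theorem VecMoment.zero (s : ℝ) (m : ℕ → ProbabilityMeasure (SL 2)) : VecMoment s m 0 0 := by
  intro u
  rw [lawT, lintegral_dirac' _ (measurable_exp_log_slVec s u), slVec_one, norm_eq_of_mem_sphere]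
  simp

theorem NormMoment.zero (s : ℝ) (m : ℕ → ProbabilityMeasure (SL 2)) : NormMoment s m 0 0 := by
  have h1 : slNorm (1 : SL 2) = 1 := by simp [slNorm, opNorm]
  rw [NormMoment, lawT, lintegral_dirac' _ (measurable_exp_log_slNorm s), h1]
  simp

section Blocks

variable {γ C s d : ℝ} {N : ℕ} {K : Set (ProbabilityMeasure (SL 2))}
  {m : ℕ → ProbabilityMeasure (SL 2)}

theorem VecMoment.blocks (hm : ∀ i, m i ∈ K)
    (h : ∀ m : ℕ → ProbabilityMeasure (SL 2), (∀ i, m i ∈ K) →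
      VecMoment s m N (-s * ∫ A, Real.log (slNorm A) ∂(lawT m N) + d)) (q : ℕ) :
    VecMoment s m (q * N) (-s * blockSum N m q + q * d) := by
  induction q with
  | zero => simpa [blockSum] using VecMoment.zero s m
  | succ q ih =>
    rw [Nat.succ_mul]
    refine (VecMoment.add ih (h (shiftSeq (q * N) m) fun i => hm _)).mono (le_of_eq ?_)
    rw [blockSum, blockSum, Finset.sum_range_succ]
    push_cast
    ring

theorem NormMoment.blocks (hs : 0 ≤ s) (hm : ∀ i, m i ∈ K)
    (h : ∀ m : ℕ → ProbabilityMeasure (SL 2), (∀ i, m i ∈ K) →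
      NormMoment s m N (s * ∫ A, Real.log (slNorm A) ∂(lawT m N) + d)) (q : ℕ) :
    NormMoment s m (q * N) (s * blockSum N m q + q * d) := by
  induction q with
  | zero => simpa [blockSum] using NormMoment.zero s m
  | succ q ih =>
    rw [Nat.succ_mul]
    refine (NormMoment.add hs ih (h (shiftSeq (q * N) m) fun i => hm _)).mono (le_of_eq ?_)
    rw [blockSum, blockSum, Finset.sum_range_succ]
    push_cast
    ring

theorem NormMoment.of_finiteMoment (hγ : 0 < γ) (hC : 1 < C)
    (hm : ∀ i, FiniteMomentCondition γ C (m i)) (hs : s ≤ γ) {r : ℕ} (hr : r ≤ N) :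
    NormMoment s m r (N * Real.log C) := by
  have e : Real.exp (N * Real.log C) = C ^ N := by
    rw [mul_comm, Real.exp_mul, Real.exp_log (by linarith), Real.rpow_natCast]
  rw [NormMoment, e]
  calc _ ≤ ∫⁻ A, ENNReal.ofReal (slNorm A ^ γ) ∂(lawT m r) := by
        refine lintegral_mono fun A => ENNReal.ofReal_le_ofReal ?_
        rw [mul_comm, Real.exp_mul, Real.exp_log (slNorm_pos A)]
        exact Real.rpow_le_rpow_of_exponent_le (one_le_slNorm A) hs
    _ ≤ ENNReal.ofReal (C ^ r) := lintegral_slNorm_rpow_le hγ hm r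
    _ ≤ _ := ENNReal.ofReal_le_ofReal (pow_le_pow_right₀ hC.le hr)

theorem NormMoment.vecMoment (hs : 0 ≤ s) {r : ℕ} {a : ℝ} (h : NormMoment s m r a) :
    VecMoment s m r a := by
  refine fun u => le_trans (lintegral_mono fun A => ENNReal.ofReal_le_ofReal ?_) h
  gcongr
  linarith [neg_log_slNorm_le A u]

theorem le_blockSum_sub {b : ℝ} (hm : ∀ i, m i ∈ K)
    (h : ∀ m : ℕ → ProbabilityMeasure (SL 2), (∀ i, m i ∈ K) →
      b ≤ ∫ A, Real.log (slNorm A) ∂(lawT m N)) {p q : ℕ} (hpq : p ≤ q) :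
    b * ((q : ℝ) - p) ≤ blockSum N m q - blockSum N m p := by
  induction q, hpq using Nat.le_induction with
  | base => simp
  | succ q _ ih =>
    have := h (shiftSeq (q * N) m) fun i => hm _
    rw [blockSum, Finset.sum_range_succ, ← blockSum]
    push_cast
    linarith

end Blocks

theorem exists_moment_bounds {K : Set (ProbabilityMeasure (SL 2))} (hK : IsCompact K)
    {γ C : ℝ} (hγ : 0 < γ) (hC : 1 < C) (hmom : ∀ μ ∈ K, FiniteMomentCondition γ C μ)
    (hmeas : ∀ μ ∈ K, MeasuresCondition μ) :
    ∃ c : ℝ, 0 < c ∧ ∀ m : ℕ → ProbabilityMeasure (SL 2), (∀ i, m i ∈ K) → ∀ ε > 0,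
      ∃ s κ : ℝ, 0 < s ∧ (∀ n, VecMoment s m n
        (-s * ∫ A, Real.log (slNorm A) ∂(lawT m n) + ε * s * n + κ)) ∧
      (∀ n, NormMoment s m n (s * ∫ A, Real.log (slNorm A) ∂(lawT m n) + ε * s * n + κ)) ∧
      ∀ k n : ℕ, k ≤ n → c * ((n : ℝ) - k) - ε * (k + n) - κ ≤
        ∫ A, Real.log (slNorm A) ∂(lawT m n) - ∫ A, Real.log (slNorm A) ∂(lawT m k) := by
  obtain ⟨ρ, hρ0, hρ1, hρ⟩ := exists_decay hK hγ hmom hmeas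
  have hc0 : 0 < -Real.log ρ / 2 := by linarith [Real.log_neg hρ0 hρ1]
  refine ⟨-Real.log ρ / 2, hc0, fun m hm ε' hε' => ?_⟩
  set c := -Real.log ρ / 2 with hc
  obtain ⟨ε, hε, rfl⟩ : ∃ ε : ℝ, 0 < ε ∧ ε' = 4 * ε := ⟨ε' / 4, by positivity, by ring⟩
  obtain ⟨N, hN, hvec⟩ := exists_vector_bound hK hγ hC hmom hρ1
    (fun m hm n => (hρ m hm n).1) (half_pos hε)
  have hN' : (0 : ℝ) < N := by exact_mod_cast hN
  set V := 16 / γ ^ 2 * C ^ N with hV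
  have hV0 : 0 < V := by positivity
  set s := min (γ / 2) (ε / 2 * N / V) with hs
  have hs0 : 0 < s := lt_min (by positivity) (by positivity)
  have hsγ : s ≤ γ / 2 := min_le_left _ _
  have hsV : s ^ 2 * V ≤ s * (ε / 2 * N) := by
    have : s * V ≤ ε / 2 * N := (le_div_iff₀ hV0).1 (min_le_right _ _)
    rw [sq, mul_assoc]
    exact mul_le_mul_of_nonneg_left this hs0.le
  have hmomK : ∀ m : ℕ → ProbabilityMeasure (SL 2), (∀ i, m i ∈ K) →
      ∀ i, FiniteMomentCondition γ C (m i) := fun m hm i => hmom _ (hm i)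
  have hb1 : ∀ m : ℕ → ProbabilityMeasure (SL 2), (∀ i, m i ∈ K) →
      VecMoment s m N (-s * ∫ A, Real.log (slNorm A) ∂(lawT m N) + s * ε * N) := by
    intro m hm u
    refine (lintegral_exp_le hγ (hmomK m hm) N
      (Real.measurable_log.comp (measurable_norm_slVec _)).neg
      (fun A => by simpa using abs_log_norm_slVec_le A u) hs0.le hsγ).trans ?_
    refine ENNReal.ofReal_le_ofReal (Real.exp_le_exp.2 ?_)
    have h1 := mul_le_mul_of_nonneg_left (hvec m hm u) hs0.le
    simp only [Pi.neg_apply, Function.comp_apply, integral_neg]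
    linarith
  have hb2 : ∀ m : ℕ → ProbabilityMeasure (SL 2), (∀ i, m i ∈ K) →
      NormMoment s m N (s * ∫ A, Real.log (slNorm A) ∂(lawT m N) + s * ε * N) := by
    intro m hm
    refine (lintegral_exp_le hγ (hmomK m hm) N measurable_log_slNorm
      (fun A => (abs_of_nonneg (log_slNorm_nonneg A)).le) hs0.le hsγ).trans ?_
    refine ENNReal.ofReal_le_ofReal (Real.exp_le_exp.2 ?_)
    have : 0 ≤ s * ε * N := by positivity
    linarith
  set R := N * Real.log C with hR
  have hR0 : 0 ≤ R := mul_nonneg hN'.le (Real.log_pos hC).le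
  set G : ℕ → ℝ := fun n => blockSum N m (n / N) with hG
  set l : ℕ → ℝ := fun n => ∫ A, Real.log (slNorm A) ∂(lawT m n) with hl
  have hdiv : ∀ n : ℕ, N * ((n / N : ℕ) : ℝ) ≤ n := fun n => by
    exact_mod_cast Nat.mul_div_le n N
  have hdivs : ∀ n : ℕ, ((n / N : ℕ) : ℝ) * (s * ε * N) ≤ s * ε * n := fun n => by
    have := mul_le_mul_of_nonneg_left (hdiv n) (by positivity : 0 ≤ s * ε)
    linarith
  have hrem : ∀ n, NormMoment s (shiftSeq (n / N * N) m) (n % N) R := fun n =>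
    NormMoment.of_finiteMoment hγ hC (hmomK _ fun i => hm _) (by linarith)
      (Nat.mod_lt n hN).le
  have hvecM : ∀ n, VecMoment s m n (-s * G n + s * ε * n + R) := by
    intro n
    have h := VecMoment.add (VecMoment.blocks hm hb1 (n / N)) ((hrem n).vecMoment hs0.le)
    rw [Nat.div_add_mod'] at h
    exact h.mono (by linarith [hdivs n])
  have hnormM : ∀ n, NormMoment s m n (s * G n + s * ε * n + R) := by
    intro n
    have h := NormMoment.add hs0.le (NormMoment.blocks hs0.le hm hb2 (n / N)) (hrem n)
    rw [Nat.div_add_mod'] at h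
    exact h.mono (by linarith [hdivs n])
  have hup : ∀ n, s * l n ≤ s * G n + s * ε * n + R := fun n =>
    mul_integral_le_of_lintegral_exp (integrable_log_slNorm hγ (hmomK m hm) n)
      measurable_log_slNorm (hnormM n)
  have hlow : ∀ n, s * G n - s * ε * n - R ≤ s * l n := by
    intro n
    let u : Circ := ⟨EuclideanSpace.single 0 1, by simp⟩
    have i1 := integrable_log_norm_slVec hγ (hmomK m hm) n u
    have h1 := mul_integral_le_of_lintegral_exp i1.neg
      (Real.measurable_log.comp (measurable_norm_slVec _)).neg (hvecM n u)
    have h2 := integral_mono i1 (integrable_log_slNorm hγ (hmomK m hm) n)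
      fun A => log_norm_slVec_le A u
    have h3 := mul_le_mul_of_nonneg_left h2 hs0.le
    simp only [Pi.neg_apply, integral_neg] at h1
    simp only [hl]
    linarith
  have hRs : 0 ≤ R / s := by positivity
  have hcN : 0 ≤ c * N := by positivity
  refine ⟨s, 2 * R + 2 * (R / s) + c * N, hs0, fun n => (hvecM n).mono ?_,
    fun n => (hnormM n).mono ?_, fun k n hkn => ?_⟩
  · have := hup n
    have h4 : 0 ≤ s * ε * n := by positivity
    simp only [hl] at this ⊢
    linarith
  · have := hlow n
    have h4 : 0 ≤ s * ε * n := by positivity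
    simp only [hl] at this ⊢
    linarith
  · have h1 := le_blockSum_sub (N := N) (b := N * c) hm (fun m hm =>
      le_integral_log_slNorm hγ (hmomK m hm) N hρ0 (hρ m hm N).2) (Nat.div_le_div_right (c := N) hkn)
    have h2 : (n : ℝ) ≤ N * ((n / N : ℕ) : ℝ) + N := by
      have := Nat.lt_mul_div_succ n hN
      rw [mul_add, mul_one] at this
      exact_mod_cast this.le
    have h3 : c * ((n : ℝ) - k) - c * N ≤ G n - G k := by
      refine le_trans ?_ h1
      have := mul_le_mul_of_nonneg_left h2 hc0.le
      have := mul_le_mul_of_nonneg_left (hdiv k) hc0.le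
      linarith
    have h4 : G n - ε * n - R / s ≤ l n := by
      refine le_of_mul_le_mul_left ?_ hs0
      have : s * (R / s) = R := by field_simp
      linarith [hlow n]
    have h5 : l k ≤ G k + ε * k + R / s := by
      refine le_of_mul_le_mul_left ?_ hs0
      have : s * (R / s) = R := by field_simp
      linarith [hup k]
    have h6 : 0 ≤ ε * (k + n) := by positivity
    change _ ≤ l n - l k
    linarith

theorem measurable_T (n : ℕ) : Measurable (fun ω : ℕ → SL 2 => T ω n) := by
  induction n with
  | zero => exact measurable_const
  | succ n ih => exact (measurable_pi_apply n).mul ih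

theorem T_congr {ω ω' : ℕ → SL 2} {n : ℕ} (h : ∀ i < n, ω i = ω' i) : T ω n = T ω' n := by
  induction n with
  | zero => rfl
  | succ n ih => rw [T, T, h n n.lt_succ_self, ih fun i hi => h i (hi.trans n.lt_succ_self)]

section Law

variable {μ : ℕ → ProbabilityMeasure (SL 2)} {ℙ : Measure (ℕ → SL 2)}

theorem IsProductMeasure.map_prodMk (hℙ : IsProductMeasure μ ℙ) (n : ℕ) :
    ℙ.map (fun ω => (ω n, fun i : Fin n => ω i)) =
      (μ n : Measure (SL 2)).prod (Measure.pi fun i : Fin n => (μ i : Measure (SL 2))) := by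
  have h := (measurePreserving_piFinSuccAbove
    (fun i : Fin (n + 1) => (μ i : Measure (SL 2))) (Fin.last n)).map_eq
  rw [← hℙ.2 (n + 1), Measure.map_map (MeasurableEquiv.measurable _) (by fun_prop)] at h
  simp only [Fin.val_last, Fin.succAbove_last, Fin.val_castSucc] at h
  rw [← h]
  congr 1
  ext ω : 2
  · simp [MeasurableEquiv.piFinSuccAbove, Fin.insertNthEquiv]
  · ext i : 1
    simp [MeasurableEquiv.piFinSuccAbove, Fin.insertNthEquiv, Fin.init]

theorem IsProductMeasure.map_eval (hℙ : IsProductMeasure μ ℙ) (n : ℕ) :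
    ℙ.map (fun ω => ω n) = (μ n : Measure (SL 2)) := by
  have h := congrArg (Measure.map Prod.fst) (hℙ.map_prodMk n)
  rw [Measure.map_map measurable_fst (by fun_prop), Measure.map_fst_prod] at h
  simpa [Function.comp_def] using h

theorem IsProductMeasure.map_prodMk_T (hℙ : IsProductMeasure μ ℙ) (n : ℕ) :
    ℙ.map (fun ω => (ω n, T ω n)) = (μ n : Measure (SL 2)).prod (ℙ.map fun ω => T ω n) := by
  have := hℙ.1
  let ext : (Fin n → SL 2) → ℕ → SL 2 := fun x i => if h : i < n then x ⟨i, h⟩ else 1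
  have hext : Measurable ext := by
    refine measurable_pi_lambda _ fun i => ?_
    by_cases h : i < n
    · simp only [ext, h, dite_true]; fun_prop
    · simp only [ext, h, dite_false]; fun_prop
  let F : (Fin n → SL 2) → SL 2 := fun x => T (ext x) n
  have hF : Measurable F := (measurable_T n).comp hext
  have hFT : ∀ ω : ℕ → SL 2, F (fun i : Fin n => ω i) = T ω n := fun ω =>
    T_congr fun i hi => by simp [ext, hi]
  have h1 : (ℙ.map fun ω => T ω n) =
      (Measure.pi fun i : Fin n => (μ i : Measure (SL 2))).map F := by
    rw [← hℙ.2 n, Measure.map_map hF (by fun_prop)]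
    congr 1
    ext1 ω
    exact (hFT ω).symm
  have hp : IsProbabilityMeasure ((Measure.pi fun i : Fin n => (μ i : Measure (SL 2))).map F) :=
    Measure.isProbabilityMeasure_map hF.aemeasurable
  have h2 := Measure.map_prod_map (μ n : Measure (SL 2))
    (Measure.pi fun i : Fin n => (μ i : Measure (SL 2))) measurable_id hF
  rw [Measure.map_id] at h2
  rw [h1, h2, ← hℙ.map_prodMk n, Measure.map_map (by fun_prop) (by fun_prop)]
  congr 1
  ext1 ω
  simp [hFT]

theorem IsProductMeasure.map_T (hℙ : IsProductMeasure μ ℙ) (n : ℕ) :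
    ℙ.map (fun ω => T ω n) = lawT μ n := by
  have := hℙ.1
  induction n with
  | zero => simp [T, lawT, Measure.map_const]
  | succ n ih =>
    rw [lawT, ← ih, Measure.mconv, ← hℙ.map_prodMk_T n,
      Measure.map_map measurable_mul ((measurable_pi_apply n).prodMk (measurable_T n))]
    rfl

theorem IsProductMeasure.L_eq (hℙ : IsProductMeasure μ ℙ) (n : ℕ) :
    L ℙ n = ∫ A, Real.log (slNorm A) ∂(lawT μ n) := by
  rw [L, ← hℙ.map_T n, integral_map (measurable_T n).aemeasurable
    measurable_log_slNorm.aestronglyMeasurable]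

end Law

/-- Chernoff's bound combined with the Borel–Cantelli lemma. -/
theorem ae_eventually_le_of_lintegral_exp_le {Ω : Type*} [MeasurableSpace Ω] {P : Measure Ω}
    {X : ℕ → Ω → ℝ} (hX : ∀ n, Measurable (X n)) {a : ℕ → ℝ} {s ε κ : ℝ} (hs : 0 < s)
    (hε : 0 < ε) (h : ∀ n, ∫⁻ ω, ENNReal.ofReal (Real.exp (s * X n ω)) ∂P ≤
      ENNReal.ofReal (Real.exp (s * a n + ε * s * n + κ))) :
    ∀ᵐ ω ∂P, ∀ᶠ n in atTop, X n ω ≤ a n + 2 * ε * n := by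
  have hle : ∀ n : ℕ, P {ω | a n + 2 * ε * n < X n ω} ≤
      ENNReal.ofReal (Real.exp κ * Real.exp (-(ε * s)) ^ n) := by
    intro n
    set b := ENNReal.ofReal (Real.exp (s * (a n + 2 * ε * n))) with hb
    have hb0 : b ≠ 0 := by rw [hb]; simp [Real.exp_pos]
    have hbt : b ≠ ⊤ := ENNReal.ofReal_ne_top
    have hm : Measurable fun ω => ENNReal.ofReal (Real.exp (s * X n ω)) := by
      have := hX n
      fun_prop
    have h1 : b * P {ω | a n + 2 * ε * n < X n ω} ≤
        ENNReal.ofReal (Real.exp (s * a n + ε * s * n + κ)) := by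
      refine le_trans ?_ (h n)
      refine le_trans ?_ (mul_meas_ge_le_lintegral hm b)
      refine mul_le_mul_right (measure_mono fun ω hω => ?_) _
      refine ENNReal.ofReal_le_ofReal (Real.exp_le_exp.2 ?_)
      exact mul_le_mul_of_nonneg_left (le_of_lt hω) hs.le
    have h2 : ENNReal.ofReal (Real.exp (s * a n + ε * s * n + κ)) =
        b * ENNReal.ofReal (Real.exp κ * Real.exp (-(ε * s)) ^ n) := by
      rw [hb, ← ENNReal.ofReal_mul (Real.exp_pos _).le, ← Real.exp_nat_mul, ← Real.exp_add,
        ← Real.exp_add]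
      congr 2
      ring
    rw [h2] at h1
    exact (ENNReal.mul_le_mul_iff_right hb0 hbt).1 h1
  have hsum : Summable fun n : ℕ => Real.exp κ * Real.exp (-(ε * s)) ^ n := by
    refine (summable_geometric_of_lt_one (Real.exp_pos _).le ?_).mul_left _
    rw [Real.exp_lt_one_iff]
    have : 0 < ε * s := by positivity
    linarith
  have hfin : ∑' n, P {ω | a n + 2 * ε * n < X n ω} ≠ ⊤ :=
    ne_top_of_le_ne_top hsum.tsum_ofReal_ne_top (ENNReal.tsum_le_tsum hle)
  filter_upwards [ae_eventually_notMem hfin] with ω hω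
  filter_upwards [hω] with n hn
  exact not_lt.1 hn

theorem norm_mul_norm_eq_one {p w : EuclideanSpace ℝ (Fin 2)} (h0 : inner ℝ p w = 0)
    (h1 : wedge p w = 1) : ‖p‖ * ‖w‖ = 1 := by
  rw [inner_two] at h0
  rw [wedge] at h1
  rw [← sq_eq_sq₀ (by positivity) zero_le_one, mul_pow, norm_sq_two, norm_sq_two]
  linear_combination (p 0 * w 1 - p 1 * w 0 + 1) * h1 + (p 0 * w 0 + p 1 * w 1) * h0

theorem wedge_sub_smul (p q : EuclideanSpace ℝ (Fin 2)) (t : ℝ) :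
    wedge p (q - t • p) = wedge p q := by
  simp [wedge]; ring

/-- The coefficient of the orthogonal projection of `q` to the line spanned by `p`. -/
def shear (p q : EuclideanSpace ℝ (Fin 2)) : ℝ := inner ℝ p q / ‖p‖ ^ 2

theorem inner_sub_shear {p : EuclideanSpace ℝ (Fin 2)} (hp : p ≠ 0)
    (q : EuclideanSpace ℝ (Fin 2)) : inner ℝ p (q - shear p q • p) = 0 := by
  have : ‖p‖ ≠ 0 := norm_ne_zero_iff.2 hp
  rw [inner_sub_right, real_inner_smul_right, real_inner_self_eq_norm_sq, shear,
    div_mul_cancel₀ _ (pow_ne_zero 2 this), sub_self]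

theorem norm_sub_shear {p q : EuclideanSpace ℝ (Fin 2)} (hp : p ≠ 0) (h : wedge p q = 1) :
    ‖q - shear p q • p‖ = ‖p‖⁻¹ := by
  refine eq_inv_of_mul_eq_one_right ?_
  exact norm_mul_norm_eq_one (inner_sub_shear hp q) (by rw [wedge_sub_smul, h])

theorem abs_shear_sub_le (A : SL 2) {p q : EuclideanSpace ℝ (Fin 2)} (hp : p ≠ 0)
    (h : wedge p q = 1) :
    |shear (slVec A p) (slVec A q) - shear p q| ≤ slNorm A * (‖p‖⁻¹ * ‖slVec A p‖⁻¹) := by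
  have hAp := slVec_ne_zero A hp
  have hn : 0 < ‖slVec A p‖ := norm_pos_iff.2 hAp
  have e : (shear (slVec A p) (slVec A q) - shear p q) * ‖slVec A p‖ ^ 2 =
      inner ℝ (slVec A p) (slVec A (q - shear p q • p)) := by
    rw [slVec_sub, slVec_smul, inner_sub_right, real_inner_smul_right, real_inner_self_eq_norm_sq,
      sub_mul, shear.eq_1 (slVec A p), div_mul_cancel₀ _ (pow_ne_zero 2 hn.ne')]
  have h1 := abs_real_inner_le_norm (slVec A p) (slVec A (q - shear p q • p))
  have h2 := norm_slVec_le A (q - shear p q • p)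
  rw [norm_sub_shear hp h] at h2
  rw [← e, abs_mul, abs_of_nonneg (sq_nonneg ‖slVec A p‖)] at h1
  have h3 : |shear (slVec A p) (slVec A q) - shear p q| * ‖slVec A p‖ ≤ slNorm A * ‖p‖⁻¹ := by
    refine le_trans ?_ h2
    refine le_of_mul_le_mul_right ?_ hn
    linarith
  rw [← mul_assoc, ← div_eq_mul_inv, le_div_iff₀ hn]
  exact h3

section Contracted

variable {ω : ℕ → SL 2} {l : ℕ → ℝ} {c : ℝ} {e₁ e₂ : EuclideanSpace ℝ (Fin 2)}

theorem slVec_T_succ (ω : ℕ → SL 2) (n : ℕ) (v : EuclideanSpace ℝ (Fin 2)) :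
    slVec (T ω (n + 1)) v = slVec (ω n) (slVec (T ω n) v) := by
  rw [T, slVec_mul]

/-- Geometric decay of the increments of the shear coefficients along the orbit. -/
theorem exists_abs_shear_sub_le (he : wedge e₁ e₂ = 1)
    (hgrow : ∀ ε > 0, ∃ κ, ∀ k n : ℕ, k ≤ n → c * ((n : ℝ) - k) - ε * (k + n) - κ ≤ l n - l k)
    (hlow : ∀ ε > 0, ∀ᶠ n : ℕ in atTop, l n - ε * n ≤ Real.log ‖slVec (T ω n) e₁‖)
    (hstep : ∀ ε > 0, ∀ᶠ n : ℕ in atTop, Real.log (slNorm (ω n)) ≤ ε * n)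
    {ε : ℝ} (hε : 0 < ε) (hεc : 5 * ε ≤ c) :
    ∃ κ, ∀ᶠ n : ℕ in atTop, ∀ j : ℕ,
      |shear (slVec (T ω (n + j)) e₁) (slVec (T ω (n + j)) e₂) -
        shear (slVec (T ω (n + j + 1)) e₁) (slVec (T ω (n + j + 1)) e₂)| ≤
        Real.exp (7 * ε * n + κ - 2 * l n) * Real.exp (-c) ^ j := by
  have he₁ : e₁ ≠ 0 := by rintro rfl; simp [wedge] at he
  obtain ⟨κ, hκ⟩ := hgrow ε hε
  obtain ⟨n₀, hn₀⟩ := eventually_atTop.1 ((hlow ε hε).and (hstep ε hε))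
  refine ⟨2 * ε + 2 * κ, ?_⟩
  filter_upwards [eventually_ge_atTop n₀] with n hn j
  set p := slVec (T ω (n + j)) e₁ with hp
  have hp0 : p ≠ 0 := slVec_ne_zero _ he₁
  have h1 := abs_shear_sub_le (ω (n + j)) hp0 (q := slVec (T ω (n + j)) e₂)
    (by rw [hp, wedge_slVec, he])
  rw [slVec_T_succ, slVec_T_succ, abs_sub_comm]
  refine h1.trans ?_
  have hq0 : slVec (ω (n + j)) p ≠ 0 := slVec_ne_zero _ hp0
  have a1 := (hn₀ (n + j) (by omega)).1
  have a2 := (hn₀ (n + j + 1) (by omega)).1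
  have a3 := (hn₀ (n + j) (by omega)).2
  have g1 := hκ n (n + j) (by omega)
  have g2 := hκ n (n + j + 1) (by omega)
  rw [slVec_T_succ, ← hp] at a2
  rw [← hp] at a1
  rw [← Real.exp_log (slNorm_pos (ω (n + j))), ← Real.exp_log (norm_pos_iff.2 hp0),
    ← Real.exp_log (norm_pos_iff.2 hq0), ← Real.exp_neg, ← Real.exp_neg, ← Real.exp_add,
    ← Real.exp_add, ← Real.exp_nat_mul, ← Real.exp_add]
  refine Real.exp_le_exp.2 ?_
  push_cast at a1 a2 a3 g1 g2
  have : 5 * ε * j ≤ c * j := by gcongr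
  linarith

theorem exists_log_bound (hc : 0 < c) (he : wedge e₁ e₂ = 1) (he1 : ‖e₁‖ = 1)
    (hgrow : ∀ ε > 0, ∃ κ, ∀ k n : ℕ, k ≤ n → c * ((n : ℝ) - k) - ε * (k + n) - κ ≤ l n - l k)
    (hlow : ∀ ε > 0, ∀ᶠ n : ℕ in atTop, l n - ε * n ≤ Real.log ‖slVec (T ω n) e₁‖)
    (hup : ∀ ε > 0, ∀ᶠ n : ℕ in atTop, Real.log (slNorm (T ω n)) ≤ l n + ε * n)
    (hstep : ∀ ε > 0, ∀ᶠ n : ℕ in atTop, Real.log (slNorm (ω n)) ≤ ε * n) :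
    ∃ v : Circ, ∀ ε > 0, ∃ κ, ∀ᶠ n : ℕ in atTop,
      |Real.log ‖slVec (T ω n) (v : EuclideanSpace ℝ (Fin 2))‖ + l n| ≤ ε * n + κ := by
  have he₁ : e₁ ≠ 0 := by rintro rfl; simp [wedge] at he
  have hr : Real.exp (-c) < 1 := by rw [Real.exp_lt_one_iff]; linarith
  set t : ℕ → ℝ := fun n => shear (slVec (T ω n) e₁) (slVec (T ω n) e₂) with ht
  obtain ⟨τ, hτ⟩ : ∃ τ, Tendsto t atTop (nhds τ) := by
    obtain ⟨κ, hκ⟩ := exists_abs_shear_sub_le he hgrow hlow hstep (ε := c / 5) (by positivity)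
      (by linarith)
    obtain ⟨n, hn⟩ := hκ.exists
    obtain ⟨τ, hτ⟩ := cauchySeq_tendsto_of_complete
      (cauchySeq_of_le_geometric (f := fun j => t (n + j)) _ _ hr fun j => hn j)
    refine ⟨τ, (tendsto_add_atTop_iff_nat n).1 ?_⟩
    simpa only [add_comm] using hτ
  set v := e₂ - τ • e₁ with hv
  have hv0 : v ≠ 0 := by
    intro h
    have h2 := wedge_sub_smul e₁ e₂ τ
    rw [← hv, h, he] at h2
    simp [wedge] at h2
  have hvn : 0 < ‖v‖ := norm_pos_iff.2 hv0
  refine ⟨dir v, ?_⟩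
  have key : ∀ ε > 0, 5 * ε ≤ c → ∃ κ, ∀ᶠ n : ℕ in atTop,
      |Real.log ‖slVec (T ω n) (dir v : EuclideanSpace ℝ (Fin 2))‖ + l n| ≤ 8 * ε * n + κ := by
    intro ε hε hεc
    obtain ⟨κ, hκ⟩ := exists_abs_shear_sub_le he hgrow hlow hstep hε hεc
    set S := Real.exp κ / (1 - Real.exp (-c)) with hS
    have hS0 : 0 < S := div_pos (Real.exp_pos _) (by linarith)
    refine ⟨Real.log (1 + S) + |Real.log ‖v‖|, ?_⟩
    filter_upwards [hκ, hlow ε hε, hup ε hε] with n h1 h2 h3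
    have hεn : 0 ≤ ε * n := by positivity
    have hlS : 0 ≤ Real.log (1 + S) := Real.log_nonneg (by linarith)
    set p := slVec (T ω n) e₁ with hp
    have hp0 : p ≠ 0 := slVec_ne_zero _ he₁
    have hTv0 : 0 < ‖slVec (T ω n) v‖ := norm_pos_iff.2 (slVec_ne_zero _ hv0)
    have elog : Real.log ‖slVec (T ω n) (dir v : EuclideanSpace ℝ (Fin 2))‖ =
        Real.log ‖slVec (T ω n) v‖ - Real.log ‖v‖ := by
      rw [coe_dir hv0, slVec_smul, norm_smul, norm_inv, norm_norm,
        Real.log_mul (inv_pos.2 hvn).ne' hTv0.ne', Real.log_inv]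
      ring
    have hlower : -(ε * n) ≤ Real.log ‖slVec (T ω n) (dir v : EuclideanSpace ℝ (Fin 2))‖ + l n := by
      have := neg_log_slNorm_le (T ω n) (dir v)
      linarith
    have hdist : |t n - τ| ≤ Real.exp (7 * ε * n - 2 * l n) * S := by
      have h4 := dist_le_of_le_geometric_of_tendsto₀ (f := fun j => t (n + j)) _ _ hr
        (fun j => h1 j) (a := τ) (by
          have := (tendsto_add_atTop_iff_nat n).2 hτ
          simpa only [add_comm] using this)
      rw [Real.dist_eq, add_zero] at h4
      refine h4.trans (le_of_eq ?_)
      rw [hS, mul_div_assoc', ← Real.exp_add]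
      congr 2
      ring
    have hpl : ‖p‖ ≤ Real.exp (l n + ε * n) := by
      have h5 := norm_slVec_le (T ω n) e₁
      rw [he1, mul_one] at h5
      exact h5.trans ((Real.log_le_iff_le_exp (slNorm_pos _)).1 h3)
    have hpi : ‖p‖⁻¹ ≤ Real.exp (-l n + ε * n) := by
      rw [← Real.exp_log (norm_pos_iff.2 hp0), ← Real.exp_neg]
      exact Real.exp_le_exp.2 (by linarith)
    have hTv : slVec (T ω n) v = (slVec (T ω n) e₂ - t n • p) + (t n - τ) • p := by
      rw [hv, slVec_sub, slVec_smul, sub_smul]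
      abel
    have hupper : ‖slVec (T ω n) v‖ ≤ Real.exp (-l n + 8 * ε * n) * (1 + S) := by
      have hw : ‖slVec (T ω n) e₂ - t n • p‖ = ‖p‖⁻¹ :=
        norm_sub_shear hp0 (by rw [wedge_slVec, he])
      calc ‖slVec (T ω n) v‖ ≤ ‖p‖⁻¹ + |t n - τ| * ‖p‖ := by
            rw [hTv]
            refine (norm_add_le _ _).trans ?_
            rw [hw, norm_smul, Real.norm_eq_abs]
        _ ≤ Real.exp (-l n + 8 * ε * n) +
            (Real.exp (7 * ε * n - 2 * l n) * S) * Real.exp (l n + ε * n) := by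
            gcongr
            exact hpi.trans (Real.exp_le_exp.2 (by linarith))
        _ = _ := by
            have e : Real.exp (7 * ε * n - 2 * l n) * Real.exp (l n + ε * n) =
                Real.exp (-l n + 8 * ε * n) := by
              rw [← Real.exp_add]
              congr 1
              ring
            rw [← e]
            ring
    have hul := Real.log_le_log hTv0 hupper
    rw [Real.log_mul (Real.exp_pos _).ne' (by positivity), Real.log_exp] at hul
    have h7 := neg_abs_le (Real.log ‖v‖)
    have h8 := abs_nonneg (Real.log ‖v‖)
    exact abs_le.2 ⟨by linarith, by linarith⟩
  intro ε hε
  obtain ⟨κ, hκ⟩ := key (min (ε / 8) (c / 5)) (lt_min (by positivity) (by positivity))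
    (by linarith [min_le_right (ε / 8) (c / 5)])
  refine ⟨κ, hκ.mono fun n hn => hn.trans ?_⟩
  have := min_le_left (ε / 8) (c / 5)
  gcongr
  linarith

end Contracted

theorem tendsto_div_of_sublinear {x : ℕ → ℝ}
    (h : ∀ ε > 0, ∃ κ : ℝ, ∀ᶠ n : ℕ in atTop, |x n| ≤ ε * n + κ) :
    Tendsto (fun n : ℕ => x n / n) atTop (nhds 0) := by
  rw [Metric.tendsto_nhds]
  intro ε hε
  obtain ⟨κ, hκ⟩ := h (ε / 2) (by positivity)
  have h1 : Tendsto (fun n : ℕ => ε / 2 * (n : ℝ)) atTop atTop :=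
    tendsto_natCast_atTop_atTop.const_mul_atTop (by positivity)
  filter_upwards [hκ, h1.eventually_gt_atTop κ, eventually_gt_atTop 0] with n h2 h3 h4
  have hn : (0 : ℝ) < n := by exact_mod_cast h4
  rw [dist_zero_right, Real.norm_eq_abs, abs_div, Nat.abs_cast, div_lt_iff₀ hn]
  linarith

theorem tendsto_zero_of_log_add_sublinear {y l : ℕ → ℝ} {c : ℝ} (hy : ∀ n, 0 < y n) (hc : 0 < c)
    (hgrow : ∀ ε > 0, ∃ κ, ∀ k n : ℕ, k ≤ n → c * ((n : ℝ) - k) - ε * (k + n) - κ ≤ l n - l k)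
    (h : ∀ ε > 0, ∃ κ : ℝ, ∀ᶠ n : ℕ in atTop, |Real.log (y n) + l n| ≤ ε * n + κ) :
    Tendsto y atTop (nhds 0) := by
  obtain ⟨κ₁, h1⟩ := hgrow (c / 4) (by positivity)
  obtain ⟨κ₂, h2⟩ := h (c / 4) (by positivity)
  have h3 : Tendsto (fun n : ℕ => κ₁ + κ₂ - l 0 + -(c / 2) * (n : ℝ)) atTop atBot :=
    tendsto_atBot_add_const_left _ _
      (tendsto_natCast_atTop_atTop.const_mul_atTop_of_neg (by linarith))
  have h4 : Tendsto (fun n => Real.log (y n)) atTop atBot := by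
    refine tendsto_atBot_mono' _ ?_ h3
    filter_upwards [h2] with n hn
    have h5 := h1 0 n n.zero_le
    have h6 := (abs_le.1 hn).2
    push_cast at h5
    linarith
  have h5 := Real.tendsto_exp_atBot.comp h4
  refine h5.congr fun n => Real.exp_log (hy n)

section AlmostSure

variable {μ : ℕ → ProbabilityMeasure (SL 2)} {ℙ : Measure (ℕ → SL 2)}

/-- An almost sure sublinear bound may be checked for each rate separately. -/
theorem ae_forall_eventually_le {Ω : Type*} [MeasurableSpace Ω] {P : Measure Ω}
    {X : ℕ → Ω → ℝ} {a : ℕ → ℝ}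
    (h : ∀ ε > 0, ∀ᵐ ω ∂P, ∀ᶠ n : ℕ in atTop, X n ω ≤ a n + ε * n) :
    ∀ᵐ ω ∂P, ∀ ε > 0, ∀ᶠ n : ℕ in atTop, X n ω ≤ a n + ε * n := by
  have h1 : ∀ᵐ ω ∂P, ∀ j : ℕ, ∀ᶠ n : ℕ in atTop, X n ω ≤ a n + 1 / ((j : ℝ) + 1) * n :=
    ae_all_iff.2 fun j => h _ (by positivity)
  filter_upwards [h1] with ω hω ε hε
  obtain ⟨j, hj⟩ := exists_nat_one_div_lt hε
  refine (hω j).mono fun n hn => hn.trans ?_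
  gcongr

theorem IsProductMeasure.ae_eventually_le_log_norm (hℙ : IsProductMeasure μ ℙ) {s ε κ : ℝ}
    (hs : 0 < s) (hε : 0 < ε)
    (h : ∀ n, VecMoment s μ n (-s * ∫ A, Real.log (slNorm A) ∂(lawT μ n) + ε * s * n + κ))
    (u : Circ) :
    ∀ᵐ ω ∂ℙ, ∀ᶠ n : ℕ in atTop,
      -Real.log ‖slVec (T ω n) u‖ ≤
        -∫ A, Real.log (slNorm A) ∂(lawT μ n) + 2 * ε * n := by
  have hX : ∀ n, Measurable fun ω : ℕ → SL 2 =>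
      -Real.log ‖slVec (T ω n) (u : EuclideanSpace ℝ (Fin 2))‖ := fun n =>
    (Real.measurable_log.comp ((measurable_norm_slVec _).comp (measurable_T n))).neg
  refine ae_eventually_le_of_lintegral_exp_le (P := ℙ)
    (X := fun (n : ℕ) (ω : ℕ → SL 2) => -Real.log ‖slVec (T ω n) u‖)
    (a := fun n => -∫ A, Real.log (slNorm A) ∂(lawT μ n)) (κ := κ) hX hs hε fun n => ?_
  have h1 := h n u
  rw [← hℙ.map_T n, lintegral_map (measurable_exp_log_slVec s u) (measurable_T n)] at h1
  refine h1.trans_eq ?_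
  rw [hℙ.map_T n]
  congr 2
  ring

theorem IsProductMeasure.ae_eventually_log_slNorm_le (hℙ : IsProductMeasure μ ℙ) {s ε κ : ℝ}
    (hs : 0 < s) (hε : 0 < ε)
    (h : ∀ n, NormMoment s μ n (s * ∫ A, Real.log (slNorm A) ∂(lawT μ n) + ε * s * n + κ)) :
    ∀ᵐ ω ∂ℙ, ∀ᶠ n : ℕ in atTop,
      Real.log (slNorm (T ω n)) ≤ ∫ A, Real.log (slNorm A) ∂(lawT μ n) + 2 * ε * n := by
  refine ae_eventually_le_of_lintegral_exp_le (P := ℙ)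
    (X := fun (n : ℕ) (ω : ℕ → SL 2) => Real.log (slNorm (T ω n)))
    (a := fun n => ∫ A, Real.log (slNorm A) ∂(lawT μ n)) (κ := κ)
    (fun n => measurable_log_slNorm.comp (measurable_T n)) hs hε fun n => ?_
  have h1 := h n
  rw [NormMoment, ← hℙ.map_T n,
    lintegral_map (measurable_exp_log_slNorm s) (measurable_T n)] at h1
  rwa [hℙ.map_T n] at h1

theorem IsProductMeasure.ae_eventually_log_slNorm_eval_le (hℙ : IsProductMeasure μ ℙ) {γ C : ℝ}
    (hγ : 0 < γ) (hC : 0 < C) (h : ∀ n, FiniteMomentCondition γ C (μ n)) {ε : ℝ} (hε : 0 < ε) :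
    ∀ᵐ ω ∂ℙ, ∀ᶠ n : ℕ in atTop, Real.log (slNorm (ω n)) ≤ 0 + 2 * ε * n := by
  have hX : ∀ n, Measurable fun ω : ℕ → SL 2 => Real.log (slNorm (ω n)) := fun n =>
    measurable_log_slNorm.comp (measurable_pi_apply (X := fun _ : ℕ => SL 2) n)
  refine ae_eventually_le_of_lintegral_exp_le (P := ℙ)
    (X := fun (n : ℕ) (ω : ℕ → SL 2) => Real.log (slNorm (ω n)))
    (a := fun _ => 0) (κ := Real.log C) hX hγ hε fun n => ?_
  have h1 := (h n).le
  rw [← hℙ.map_eval n] at h1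
  have e : (fun A : SL 2 => ENNReal.ofReal (slNorm A ^ γ)) =
      fun A => ENNReal.ofReal (Real.exp (γ * Real.log (slNorm A))) := by
    funext A
    rw [Real.rpow_def_of_pos (slNorm_pos A), mul_comm]
  rw [e, lintegral_map (measurable_exp_log_slNorm γ) (measurable_pi_apply n)] at h1
  refine h1.trans (ENNReal.ofReal_le_ofReal ?_)
  conv_lhs => rw [← Real.exp_log hC]
  refine Real.exp_le_exp.2 ?_
  have : 0 ≤ ε * γ * n := by positivity
  linarith

end AlmostSure

/-- **Contracted direction in dimension 2** (Proposition 1.2).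
Under the finite moment and measures conditions, almost surely there is a unit vector `v̄`
with `|Tₙ v̄| → 0` and `(1/n)(log |Tₙ v̄| + Lₙ) → 0`. -/
theorem contracted_direction
    (K : Set (ProbabilityMeasure (SL 2))) (hK : IsCompact K)
    (γ C : ℝ) (hγ : 0 < γ)
    (hmom : ∀ μ ∈ K, FiniteMomentCondition γ C μ)
    (hmeas : ∀ μ ∈ K, MeasuresCondition μ)
    (μ : ℕ → ProbabilityMeasure (SL 2)) (hμ : ∀ i, μ i ∈ K)
    (ℙ : Measure (ℕ → SL 2)) (hℙ : IsProductMeasure μ ℙ) :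
    ∀ᵐ ω ∂ℙ, ∃ v : EuclideanSpace ℝ (Fin 2), ‖v‖ = 1 ∧
      Tendsto (fun n : ℕ => ‖slVec (T ω n) v‖) atTop (nhds 0) ∧
      Tendsto (fun n : ℕ => (Real.log ‖slVec (T ω n) v‖ + L ℙ n) / n) atTop (nhds 0) := by
  have hC : 1 < C := (hmom _ (hμ 0)).one_lt hγ
  obtain ⟨c, hc, hbounds⟩ := exists_moment_bounds hK hγ hC hmom hmeas
  replace hbounds := hbounds μ hμ
  set l : ℕ → ℝ := fun n => ∫ A, Real.log (slNorm A) ∂(lawT μ n) with hl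
  have hgrow : ∀ ε > 0, ∃ κ, ∀ k n : ℕ, k ≤ n →
      c * ((n : ℝ) - k) - ε * (k + n) - κ ≤ l n - l k := by
    intro ε hε
    obtain ⟨s, κ, -, -, -, h⟩ := hbounds ε hε
    exact ⟨κ, h⟩
  have he1 : ‖(EuclideanSpace.single 0 1 : EuclideanSpace ℝ (Fin 2))‖ = 1 := by simp
  let u : Circ := ⟨EuclideanSpace.single 0 1, mem_sphere_zero_iff_norm.2 he1⟩
  have hlow : ∀ᵐ ω ∂ℙ, ∀ ε > 0, ∀ᶠ n : ℕ in atTop,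
      -Real.log ‖slVec (T ω n) u‖ ≤ -l n + ε * n := by
    refine ae_forall_eventually_le fun ε hε => ?_
    obtain ⟨s, κ, hs, h, -, -⟩ := hbounds (ε / 2) (by positivity)
    have := hℙ.ae_eventually_le_log_norm hs (by positivity) h u
    rwa [mul_div_cancel₀ ε two_ne_zero] at this
  have hup : ∀ᵐ ω ∂ℙ, ∀ ε > 0, ∀ᶠ n : ℕ in atTop,
      Real.log (slNorm (T ω n)) ≤ l n + ε * n := by
    refine ae_forall_eventually_le fun ε hε => ?_
    obtain ⟨s, κ, hs, -, h, -⟩ := hbounds (ε / 2) (by positivity)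
    have := hℙ.ae_eventually_log_slNorm_le hs (by positivity) h
    rwa [mul_div_cancel₀ ε two_ne_zero] at this
  have hstep : ∀ᵐ ω ∂ℙ, ∀ ε > 0, ∀ᶠ n : ℕ in atTop,
      Real.log (slNorm (ω n)) ≤ 0 + ε * n := by
    refine ae_forall_eventually_le (a := fun _ => 0) fun ε hε => ?_
    have := hℙ.ae_eventually_log_slNorm_eval_le hγ (zero_lt_one.trans hC)
      (fun n => hmom _ (hμ n)) (half_pos hε)
    rwa [mul_div_cancel₀ ε two_ne_zero] at this
  filter_upwards [hlow, hup, hstep] with ω h1 h2 h3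
  obtain ⟨v, hv⟩ := exists_log_bound (ω := ω) (l := l) (e₁ := u)
    (e₂ := EuclideanSpace.single 1 1) hc (by simp [u, wedge]) he1 hgrow
    (fun ε hε => (h1 ε hε).mono fun n hn => by linarith) h2
    (fun ε hε => (h3 ε hε).mono fun n hn => by linarith)
  refine ⟨v, norm_eq_of_mem_sphere v, tendsto_zero_of_log_add_sublinear
    (fun n => norm_slVec_circ_pos _ v) hc hgrow hv, ?_⟩
  simp only [hℙ.L_eq]
  exact tendsto_div_of_sublinear hv
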